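/- arXiv:2109.01233 — 2 statements merged into one kernel-verified Lean document; each statement's English description precedes it below -/
import Mathlib

section
/- Let G be a triconed graph with no coloops. For every spanning tree B of G, the marked spanning forest φ1(B) is a trirooted forest of G_red: every component of φ1(B) is correctly marked and the blueprint of φ1(B) is acyclic. -/
open scoped Classical

variable {V : Type} [Fintype V] [LinearOrder V] [LinearOrder (Sym2 V)]

/-- `T` is a spanning tree of the graph `G`, viewed as a set of edges. -/
def IsSpanningTree (G : SimpleGraph V) (T : Set (Sym2 V)) : Prop :=
  T ⊆ G.edgeSet ∧ (SimpleGraph.fromEdgeSet T).IsTree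

/-- An edge `e` of the spanning tree `T` is internally passive (w.r.t. the edge order). -/
def InternallyPassive (G : SimpleGraph V) (T : Set (Sym2 V)) (e : Sym2 V) : Prop :=
  e ∈ T ∧ ∃ f ∈ G.edgeSet, f ∉ T ∧ f < e ∧ IsSpanningTree G (insert f (T \ {e}))

/-- The passivity of a spanning tree: the number of internally passive edges. -/
noncomputable def passivity (G : SimpleGraph V) (T : Set (Sym2 V)) : ℕ :=
  {e : Sym2 V | InternallyPassive G T e}.ncard

/-- `A` is lexicographically smaller than `B` as (sorted lists of) sets of edges:
the minimum of the symmetric difference lies in `A`. -/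
def EdgeSetLexLt (A B : Set (Sym2 V)) : Prop :=
  ∃ e, e ∈ A ∧ e ∉ B ∧ ∀ f, (f ∈ A ∧ f ∉ B) ∨ (f ∈ B ∧ f ∉ A) → f ≠ e → e < f

/-- `B0` is the minimum spanning tree of `G`: the spanning tree whose sorted edge
list is lexicographically smallest. -/
def IsMinSpanningTree (G : SimpleGraph V) (B0 : Set (Sym2 V)) : Prop :=
  IsSpanningTree G B0 ∧ ∀ T, IsSpanningTree G T → T ≠ B0 → EdgeSetLexLt B0 T

/-- `G` has no coloops: every edge lies outside some spanning tree. -/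
def NoColoops (G : SimpleGraph V) : Prop :=
  ∀ e ∈ G.edgeSet, ∃ T, IsSpanningTree G T ∧ e ∉ T

/-- `G` is a triconed graph with distinguished path `v1 - v0 - v2`. -/
def IsTriconed (G : SimpleGraph V) (v0 v1 v2 : V) : Prop :=
  G.Connected ∧ v0 ≠ v1 ∧ v0 ≠ v2 ∧ v1 ≠ v2 ∧ G.Adj v0 v1 ∧ G.Adj v0 v2 ∧
    ∀ v, v ≠ v0 → v ≠ v1 → v ≠ v2 → G.Adj v0 v ∨ G.Adj v1 v ∨ G.Adj v2 v

/-- The vertex order puts `v0 < v1 < v2` first, then the remaining neighbors of `v0`,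
then the remaining vertices adjacent to `v1`, then the rest. -/
def VertexOrderSpec (G : SimpleGraph V) (v0 v1 v2 : V) : Prop :=
  v0 < v1 ∧ v1 < v2 ∧
  (∀ v, v ≠ v0 → v ≠ v1 → v ≠ v2 → v2 < v) ∧
  (∀ u u', u ≠ v0 → u ≠ v1 → u ≠ v2 → u' ≠ v0 → u' ≠ v1 → u' ≠ v2 →
    G.Adj v0 u → ¬G.Adj v0 u' → u < u') ∧
  (∀ u u', u ≠ v0 → u ≠ v1 → u ≠ v2 → u' ≠ v0 → u' ≠ v1 → u' ≠ v2 →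
    ¬G.Adj v0 u → ¬G.Adj v0 u' → G.Adj v1 u → ¬G.Adj v1 u' → u < u')

/-- Smaller endpoint of an edge. -/
def sym2Min (e : Sym2 V) : V :=
  Sym2.lift ⟨fun a b => min a b, fun a b => min_comm a b⟩ e

/-- Larger endpoint of an edge. -/
def sym2Max (e : Sym2 V) : V :=
  Sym2.lift ⟨fun a b => max a b, fun a b => max_comm a b⟩ e

/-- Lexicographic comparison of edges by their endpoints. -/
def Sym2Lex (e f : Sym2 V) : Prop :=
  sym2Min e < sym2Min f ∨ (sym2Min e = sym2Min f ∧ sym2Max e < sym2Max f)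

/-- The block of an edge in the specified edge ordering: edges at `v0` first, then edges
joining `v1` to height-2 vertices, then edges joining `v2` to height-2 vertices not
adjacent to `v1`, then the remaining edges. -/
noncomputable def edgeBlock (G : SimpleGraph V) (v0 v1 v2 : V) (e : Sym2 V) : ℕ :=
  if v0 ∈ e then 0
  else if ∃ x, e = s(v1, x) ∧ ¬G.Adj v0 x then 1
  else if ∃ x, e = s(v2, x) ∧ ¬G.Adj v0 x ∧ ¬G.Adj v1 x then 2
  else 3

/-- The edge order respects the blocks, and is lexicographic within the first three blocks. -/
def EdgeOrderSpec (G : SimpleGraph V) (v0 v1 v2 : V) : Prop :=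
  (∀ e ∈ G.edgeSet, ∀ f ∈ G.edgeSet,
      edgeBlock G v0 v1 v2 e < edgeBlock G v0 v1 v2 f → e < f) ∧
  (∀ e ∈ G.edgeSet, ∀ f ∈ G.edgeSet,
      edgeBlock G v0 v1 v2 e = edgeBlock G v0 v1 v2 f → edgeBlock G v0 v1 v2 e ≤ 2 →
      Sym2Lex e f → e < f)

/-- The edges of `G_red`: edges of `G` not in `B0` and not incident to `v0`. -/
def GredEdges (G : SimpleGraph V) (v0 : V) (B0 : Set (Sym2 V)) : Set (Sym2 V) :=
  {e | e ∈ G.edgeSet ∧ e ∉ B0 ∧ v0 ∉ e}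

/-- `u` is a child of `p` in the spanning tree `B0` rooted at `v0`:
`s(u,p) ∈ B0` and removing this edge disconnects `u` from the root. -/
def IsChildOf (B0 : Set (Sym2 V)) (v0 : V) (u p : V) : Prop :=
  s(u, p) ∈ B0 ∧ ¬(SimpleGraph.fromEdgeSet (B0 \ {s(u, p)})).Reachable u v0

/-- The type of a vertex: `1` if it is `v1` or a child of `v1`, `2` if it is `v2` or a
child of `v2`, and `0` otherwise. -/
noncomputable def vType (B0 : Set (Sym2 V)) (v0 v1 v2 : V) (u : V) : ℕ :=
  if u = v1 ∨ IsChildOf B0 v0 u v1 then 1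
  else if u = v2 ∨ IsChildOf B0 v0 u v2 then 2
  else 0

/-- The height of a vertex other than `v0`: `1` if adjacent to `v0`, `2` otherwise. -/
noncomputable def vHeight (G : SimpleGraph V) (v0 : V) (u : V) : ℕ :=
  if G.Adj v0 u then 1 else 2

/-- `(E, m)` is a marked spanning forest of `G_red`: an acyclic set of `G_red`-edges
with marks on vertices, each vertex carrying at most one mark except type-2 vertices
which may carry two. -/
def IsMarkedForest (G : SimpleGraph V) (v0 v1 v2 : V) (B0 : Set (Sym2 V))
    (E : Set (Sym2 V)) (m : V → ℕ) : Prop :=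
  E ⊆ GredEdges G v0 B0 ∧ (SimpleGraph.fromEdgeSet E).IsAcyclic ∧ m v0 = 0 ∧
  ∀ v, m v ≤ if vType B0 v0 v1 v2 v = 2 then 2 else 1

/-- Total number of marks in the component of `u`. -/
noncomputable def compMarks (E : Set (Sym2 V)) (m : V → ℕ) (u : V) : ℕ :=
  ∑ x : V, if (SimpleGraph.fromEdgeSet E).Reachable u x then m x else 0

/-- Number of marks of type `t` in the component of `u` (the extra mark of a doubly
marked vertex counting as a mark of type `0`). -/
noncomputable def markTypeCount (B0 : Set (Sym2 V)) (v0 v1 v2 : V)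
    (E : Set (Sym2 V)) (m : V → ℕ) (u : V) (t : ℕ) : ℕ :=
  ∑ x : V, if (SimpleGraph.fromEdgeSet E).Reachable u x then
      ((if 1 ≤ m x ∧ vType B0 v0 v1 v2 x = t then 1 else 0) +
        (if m x = 2 ∧ t = 0 then 1 else 0))
    else 0

/-- The component of `u` in `(E, m)` is correctly marked. -/
def CorrectlyMarkedComp (B0 : Set (Sym2 V)) (v0 v1 v2 : V)
    (E : Set (Sym2 V)) (m : V → ℕ) (u : V) : Prop :=
  1 ≤ compMarks E m u ∧
  ((SimpleGraph.fromEdgeSet E).Reachable u v1 → 1 ≤ m v1) ∧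
  ((SimpleGraph.fromEdgeSet E).Reachable u v2 → 1 ≤ m v2) ∧
  (∀ t, markTypeCount B0 v0 v1 v2 E m u t ≤ 1) ∧
  (∀ x, (SimpleGraph.fromEdgeSet E).Reachable u x → m x = 2 →
    ∃ x', (SimpleGraph.fromEdgeSet E).Reachable u x' ∧ x' ≠ x ∧ 1 ≤ m x')

/-- The multiplicity of the blueprint edge `{a, b}`: the number of 2-components whose
marks have types `a` and `b`, plus (for `{a,b} ∈ {{0,1},{0,2}}`) the number of
3-components. -/
noncomputable def bpMult (B0 : Set (Sym2 V)) (v0 v1 v2 : V)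
    (E : Set (Sym2 V)) (m : V → ℕ) (a b : ℕ) : ℕ :=
  {c : (SimpleGraph.fromEdgeSet E).ConnectedComponent |
    ∃ u, u ≠ v0 ∧ (SimpleGraph.fromEdgeSet E).connectedComponentMk u = c ∧
      ((compMarks E m u = 2 ∧ a ≠ b ∧
          1 ≤ markTypeCount B0 v0 v1 v2 E m u a ∧ 1 ≤ markTypeCount B0 v0 v1 v2 E m u b) ∨
        (compMarks E m u = 3 ∧
          (({a, b} : Set ℕ) = {0, 1} ∨ ({a, b} : Set ℕ) = {0, 2})))}.ncard

/-- The blueprint (a multigraph on `{0,1,2}`) is acyclic. -/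
def bpAcyclic (B0 : Set (Sym2 V)) (v0 v1 v2 : V) (E : Set (Sym2 V)) (m : V → ℕ) : Prop :=
  bpMult B0 v0 v1 v2 E m 0 1 ≤ 1 ∧ bpMult B0 v0 v1 v2 E m 0 2 ≤ 1 ∧
  bpMult B0 v0 v1 v2 E m 1 2 ≤ 1 ∧
  ¬(1 ≤ bpMult B0 v0 v1 v2 E m 0 1 ∧ 1 ≤ bpMult B0 v0 v1 v2 E m 0 2 ∧
      1 ≤ bpMult B0 v0 v1 v2 E m 1 2)

/-- The vertices `a` and `b` of the blueprint lie in the same connected component. -/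
def bpConnected (B0 : Set (Sym2 V)) (v0 v1 v2 : V) (E : Set (Sym2 V)) (m : V → ℕ)
    (a b : ℕ) : Prop :=
  a = b ∨ 1 ≤ bpMult B0 v0 v1 v2 E m a b ∨
    ∃ c, c ∈ ({0, 1, 2} : Set ℕ) ∧ c ≠ a ∧ c ≠ b ∧
      1 ≤ bpMult B0 v0 v1 v2 E m a c ∧ 1 ≤ bpMult B0 v0 v1 v2 E m c b

/-- `(E, m)` is a trirooted forest of `G_red`. -/
def IsTriRootedForest (G : SimpleGraph V) (v0 v1 v2 : V) (B0 : Set (Sym2 V))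
    (E : Set (Sym2 V)) (m : V → ℕ) : Prop :=
  IsMarkedForest G v0 v1 v2 B0 E m ∧
  (∀ u, u ≠ v0 → CorrectlyMarkedComp B0 v0 v1 v2 E m u) ∧
  bpAcyclic B0 v0 v1 v2 E m

/-- `v` receives the extra mark coming from the edge `02`: `02 ∈ B`, there is a path
from `v2` to `v1` in `B` avoiding `02`, and `v` is the endpoint closer to `v2` of the
first edge of this path not in `B0`. -/
def DoublyMarkedAt (B0 B : Set (Sym2 V)) (v0 v1 v2 : V) (v : V) : Prop :=
  s(v0, v2) ∈ B ∧
  ∃ p : (SimpleGraph.fromEdgeSet B).Walk v2 v1, p.IsPath ∧ s(v0, v2) ∉ p.edges ∧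
    ∃ i : ℕ, (∀ j < i, ∀ e, p.edges[j]? = some e → e ∈ B0) ∧
      (∃ e, p.edges[i]? = some e ∧ e ∉ B0) ∧ v = p.getVert i

/-- `(E, m)` is the marked spanning forest `φ₁(B)` associated to the spanning tree `B`. -/
def IsPhi1 (G : SimpleGraph V) (v0 v1 v2 : V) (B0 B : Set (Sym2 V))
    (E : Set (Sym2 V)) (m : V → ℕ) : Prop :=
  E = B ∩ GredEdges G v0 B0 ∧
  (∀ v, m v ≤ 2) ∧
  (∀ v, 1 ≤ m v ↔ (v = v1 ∨ v = v2 ∨ ∃ p, IsChildOf B0 v0 v p ∧ s(v, p) ∈ B)) ∧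
  (∀ v, m v = 2 ↔ DoublyMarkedAt B0 B v0 v1 v2 v)

/-- `(S, E)` is a (sub)tree of `G_red` with vertex set `S` and edge set `E`. -/
def IsSubTree (G : SimpleGraph V) (v0 : V) (B0 : Set (Sym2 V))
    (S : Set V) (E : Set (Sym2 V)) : Prop :=
  S.Nonempty ∧ v0 ∉ S ∧ E ⊆ GredEdges G v0 B0 ∧
  (∀ e ∈ E, ∀ x ∈ e, x ∈ S) ∧
  (∀ u ∈ S, ∀ x ∈ S, (SimpleGraph.fromEdgeSet E).Reachable u x) ∧
  (SimpleGraph.fromEdgeSet E).IsAcyclic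

/-- Total number of marks of the marked tree `(S, m)`. -/
noncomputable def treeTotalMarks (S : Set V) (m : V → ℕ) : ℕ :=
  ∑ x : V, if x ∈ S then m x else 0

/-- Number of marks of type `t` of the marked tree `(S, m)`. -/
noncomputable def treeMarkTypeCount (B0 : Set (Sym2 V)) (v0 v1 v2 : V)
    (S : Set V) (m : V → ℕ) (t : ℕ) : ℕ :=
  ∑ x : V, if x ∈ S then
      ((if 1 ≤ m x ∧ vType B0 v0 v1 v2 x = t then 1 else 0) +
        (if m x = 2 ∧ t = 0 then 1 else 0))
    else 0

/-- `(S, E, m)` is a correctly marked tree of `G_red`. -/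
def IsCorrectlyMarkedTree (G : SimpleGraph V) (v0 v1 v2 : V) (B0 : Set (Sym2 V))
    (S : Set V) (E : Set (Sym2 V)) (m : V → ℕ) : Prop :=
  IsSubTree G v0 B0 S E ∧
  (∀ v, v ∉ S → m v = 0) ∧
  (∀ v, m v ≤ if vType B0 v0 v1 v2 v = 2 then 2 else 1) ∧
  1 ≤ treeTotalMarks S m ∧
  (v1 ∈ S → 1 ≤ m v1) ∧ (v2 ∈ S → 1 ≤ m v2) ∧
  (∀ t, treeMarkTypeCount B0 v0 v1 v2 S m t ≤ 1) ∧
  (∀ x ∈ S, m x = 2 → ∃ x' ∈ S, x' ≠ x ∧ 1 ≤ m x')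

/-- Number of effective marks: marks at normal vertices together with the extra marks
of doubly marked vertices. -/
noncomputable def effMarks (v1 v2 : V) (S : Set V) (m : V → ℕ) : ℕ :=
  treeTotalMarks S m -
    ((if v1 ∈ S ∧ 1 ≤ m v1 then 1 else 0) + (if v2 ∈ S ∧ 1 ≤ m v2 then 1 else 0))

/-- Number of passive effective marks: an effective mark is passive unless it is the
unique mark of the tree and lies at the smallest vertex of the tree. -/
noncomputable def passiveEffMarks (v1 v2 : V) (S : Set V) (m : V → ℕ) : ℕ :=
  effMarks v1 v2 S m -
    (if ∃ v ∈ S, v ≠ v1 ∧ v ≠ v2 ∧ 1 ≤ m v ∧ treeTotalMarks S m = 1 ∧ ∀ u ∈ S, v ≤ u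
      then 1 else 0)

/-- Total excess `Σ_{e ∈ E} (w e - 1)` of the edge weights. -/
noncomputable def excessWeightSum (E : Set (Sym2 V)) (w : Sym2 V → ℕ) : ℕ :=
  ∑ e : Sym2 V, if e ∈ E then w e - 1 else 0

/-- Excess weight of the weighted tree `(S, E, w)`. -/
noncomputable def excessWeight (v1 v2 : V) (S : Set V) (E : Set (Sym2 V))
    (w : Sym2 V → ℕ) : ℕ :=
  (if v1 ∈ S then 1 else 0) + (if v2 ∈ S then 1 else 0) + excessWeightSum E w

/-- Total weight `Σ_{e ∈ E} w e`, i.e. the total degree of the associated monomial. -/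
noncomputable def totalWeight (E : Set (Sym2 V)) (w : Sym2 V → ℕ) : ℕ :=
  ∑ e : Sym2 V, if e ∈ E then w e else 0

/-- All pairs of weighted objects of the weighted tree `(S, E, w)` are compatible:
the endpoints of the smallest path containing any two weighted objects have
different types. -/
def WeightedObjectsCompatible (B0 : Set (Sym2 V)) (v0 v1 v2 : V)
    (S : Set V) (E : Set (Sym2 V)) (w : Sym2 V → ℕ) : Prop :=
  (∀ vsp ∈ ({v1, v2} : Set V), vsp ∈ S → ∀ x y, s(x, y) ∈ E → 2 ≤ w s(x, y) →
      (SimpleGraph.fromEdgeSet (E \ {s(x, y)})).Reachable vsp x →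
      vType B0 v0 v1 v2 vsp ≠ vType B0 v0 v1 v2 y) ∧
  (∀ x y p q, s(x, y) ∈ E → s(p, q) ∈ E → s(x, y) ≠ s(p, q) →
      2 ≤ w s(x, y) → 2 ≤ w s(p, q) →
      (SimpleGraph.fromEdgeSet (E \ {s(x, y)})).Reachable x p →
      (SimpleGraph.fromEdgeSet (E \ {s(p, q)})).Reachable p x →
      vType B0 v0 v1 v2 y ≠ vType B0 v0 v1 v2 q) ∧
  (∀ x y, s(x, y) ∈ E → 3 ≤ w s(x, y) → vType B0 v0 v1 v2 x ≠ vType B0 v0 v1 v2 y)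

/-- `(S, E, w)` is a correctly weighted tree of `G_red`. -/
def IsCorrectlyWeightedTree (G : SimpleGraph V) (v0 v1 v2 : V) (B0 : Set (Sym2 V))
    (S : Set V) (E : Set (Sym2 V)) (w : Sym2 V → ℕ) : Prop :=
  IsSubTree G v0 B0 S E ∧
  (∀ e ∈ E, 1 ≤ w e) ∧
  excessWeight v1 v2 S E w ≤ 3 ∧
  (2 ≤ excessWeight v1 v2 S E w → WeightedObjectsCompatible B0 v0 v1 v2 S E w) ∧
  (∀ x y, s(x, y) ∈ E → w s(x, y) ≤ vHeight G v0 x + vHeight G v0 y) ∧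
  (∀ x y, s(x, y) ∈ E → w s(x, y) = vHeight G v0 x + vHeight G v0 y →
    ∀ e ∈ E, e ≠ s(x, y) → w e ≤ 2)

/-- `s(v, x)` is the edge incident to `v` on the unique path from `v` to `u` in the
tree with edge set `E`. -/
def PathFirstEdge (E : Set (Sym2 V)) (v u : V) (x : V) : Prop :=
  s(v, x) ∈ E ∧ ¬(SimpleGraph.fromEdgeSet (E \ {s(v, x)})).Reachable v u

/-- `z` lies on the (unique) path between `a` and `b` in the forest with edge set `E`. -/
def OnPathBetween (E : Set (Sym2 V)) (a b z : V) : Prop :=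
  ∃ p : (SimpleGraph.fromEdgeSet E).Walk a b, p.IsPath ∧ z ∈ p.support

/-- `s(x, y)` (with `x` nearer `z`, `y` nearer `v`) is the first edge along the path
from the sandwiched mark `z` towards `v` whose endpoint closer to `v` has type
different from that of `wv` and whose endpoint closer to `wv` has type different
from that of `v`. -/
def SandwichEdge (B0 : Set (Sym2 V)) (v0 v1 v2 : V) (E : Set (Sym2 V))
    (z v wv : V) (x y : V) : Prop :=
  s(x, y) ∈ E ∧
  ¬(SimpleGraph.fromEdgeSet (E \ {s(x, y)})).Reachable z v ∧
  (SimpleGraph.fromEdgeSet (E \ {s(x, y)})).Reachable z x ∧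
  vType B0 v0 v1 v2 y ≠ vType B0 v0 v1 v2 wv ∧
  vType B0 v0 v1 v2 x ≠ vType B0 v0 v1 v2 v ∧
  ∀ x' y', s(x', y') ∈ E →
    ¬(SimpleGraph.fromEdgeSet (E \ {s(x', y')})).Reachable z x →
    (SimpleGraph.fromEdgeSet (E \ {s(x', y')})).Reachable z x' →
    (vType B0 v0 v1 v2 y' = vType B0 v0 v1 v2 wv ∨ vType B0 v0 v1 v2 x' = vType B0 v0 v1 v2 v)

/-- `w` is the weighting `φ₂(S, E, m)` produced by the empowerment algorithm applied
to the correctly marked tree `(S, E, m)` (only the weights of edges of `E` are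
constrained). -/
def IsPhi2 (B0 : Set (Sym2 V)) (v0 v1 v2 : V)
    (S : Set V) (E : Set (Sym2 V)) (m : V → ℕ) (w : Sym2 V → ℕ) : Prop :=
  (treeTotalMarks S m = 1 →
    ∃ v ∈ S, m v = 1 ∧
      (((∀ u ∈ S, v ≤ u) ∧ ∀ e ∈ E, w e = 1) ∨
        (¬(∀ u ∈ S, v ≤ u) ∧ ∃ u0 ∈ S, (∀ u ∈ S, u0 ≤ u) ∧
          ∃ x, PathFirstEdge E v u0 x ∧ ∀ e ∈ E, w e = if e = s(v, x) then 2 else 1))) ∧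
  (treeTotalMarks S m = 2 →
    ∃ v ∈ S, ∃ u ∈ S, v ≠ u ∧ m v = 1 ∧ m u = 1 ∧
      ∃ x y, PathFirstEdge E v u x ∧ PathFirstEdge E u v y ∧
        ∀ e ∈ E, w e = 1 + (if v ≠ v1 ∧ v ≠ v2 ∧ e = s(v, x) then 1 else 0)
                        + (if u ≠ v1 ∧ u ≠ v2 ∧ e = s(u, y) then 1 else 0)) ∧
  (treeTotalMarks S m = 3 →
    ((∃ a ∈ S, ∃ b ∈ S, ∃ c ∈ S, a ≠ b ∧ a ≠ c ∧ b ≠ c ∧ m a = 1 ∧ m b = 1 ∧ m c = 1 ∧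
        ¬OnPathBetween E b c a ∧ ¬OnPathBetween E a c b ∧ ¬OnPathBetween E a b c ∧
        ∃ xa xb xc, PathFirstEdge E a b xa ∧ PathFirstEdge E b a xb ∧
          PathFirstEdge E c a xc ∧
          ∀ e ∈ E, w e = 1 + (if a ≠ v1 ∧ a ≠ v2 ∧ e = s(a, xa) then 1 else 0)
                          + (if b ≠ v1 ∧ b ≠ v2 ∧ e = s(b, xb) then 1 else 0)
                          + (if c ≠ v1 ∧ c ≠ v2 ∧ e = s(c, xc) then 1 else 0)) ∨
      (∃ v ∈ S, ∃ wv ∈ S, ∃ z ∈ S, v ≠ wv ∧ v ≠ z ∧ 1 ≤ m v ∧ 1 ≤ m wv ∧ 1 ≤ m z ∧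
        OnPathBetween E v wv z ∧ (z = wv → m wv = 2) ∧
        (z ≠ wv → m v = 1 ∧ m wv = 1 ∧ m z = 1) ∧
        vType B0 v0 v1 v2 v < vType B0 v0 v1 v2 wv ∧
        ∃ xv xw xz yz, PathFirstEdge E v wv xv ∧ PathFirstEdge E wv v xw ∧
          SandwichEdge B0 v0 v1 v2 E z v wv xz yz ∧
          ∀ e ∈ E, w e = 1 + (if v ≠ v1 ∧ v ≠ v2 ∧ e = s(v, xv) then 1 else 0)
                          + (if wv ≠ v1 ∧ wv ≠ v2 ∧ e = s(wv, xw) then 1 else 0)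
                          + (if e = s(xz, yz) then 1 else 0))))

/-- The vertex set of the component of `u` in the forest with edge set `E`. -/
def compVerts (E : Set (Sym2 V)) (u : V) : Set V :=
  {x | (SimpleGraph.fromEdgeSet E).Reachable u x}

/-- The edge set of the component of `u` in the forest with edge set `E`. -/
def compEdges (E : Set (Sym2 V)) (u : V) : Set (Sym2 V) :=
  {e | e ∈ E ∧ ∀ x ∈ e, (SimpleGraph.fromEdgeSet E).Reachable u x}

/-- `w` is the weighting `φ₂(E, m)` of the marked forest `(E, m)`, obtained by applying
the empowerment algorithm to every component. -/
def IsPhi2Forest (B0 : Set (Sym2 V)) (v0 v1 v2 : V)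
    (E : Set (Sym2 V)) (m : V → ℕ) (w : Sym2 V → ℕ) : Prop :=
  ∀ u, u ≠ v0 → IsPhi2 B0 v0 v1 v2 (compVerts E u) (compEdges E u)
      (fun v => if v ∈ compVerts E u then m v else 0) w

/-- `(h_0, …, h_r)` is a pure O-sequence. -/
def IsPureOSeq (r : ℕ) (h : ℕ → ℕ) : Prop :=
  ∃ (σ : Type) (_ : Finite σ) (X : Set (σ →₀ ℕ)),
    X.Finite ∧
    (∀ μ ∈ X, ∀ ν : σ →₀ ℕ, ν ≤ μ → ν ∈ X) ∧
    (∀ μ ∈ X, ∀ ν ∈ X, (∀ ρ ∈ X, μ ≤ ρ → ρ = μ) → (∀ ρ ∈ X, ν ≤ ρ → ρ = ν) →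
        μ.sum (fun _ n => n) = ν.sum (fun _ n => n)) ∧
    (∀ i, {μ ∈ X | μ.sum (fun _ n => n) = i}.ncard = if i ≤ r then h i else 0)

/-- Two edge-disjoint parts of an acyclic edge set cannot connect the same two vertices. -/
theorem key_disjoint {B X Y : Set (Sym2 V)} (hB : (SimpleGraph.fromEdgeSet B).IsAcyclic)
    (hX : X ⊆ B) (hY : Y ⊆ B) (hd : ∀ e ∈ X, e ∉ Y) {x y : V}
    (h1 : (SimpleGraph.fromEdgeSet X).Reachable x y)
    (h2 : (SimpleGraph.fromEdgeSet Y).Reachable x y) : x = y := by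
  obtain ⟨p, hp⟩ := h1.exists_isPath
  obtain ⟨q, hq⟩ := h2.exists_isPath
  have hXB := SimpleGraph.fromEdgeSet_mono hX
  have hYB := SimpleGraph.fromEdgeSet_mono hY
  have heq := hB.path_unique ⟨p.mapLe hXB, hp.mapLe hXB⟩ ⟨q.mapLe hYB, hq.mapLe hYB⟩
  have heq2 : (p.mapLe hXB).edges = (q.mapLe hYB).edges := by
    rw [Subtype.mk.injEq] at heq
    rw [heq]
  rw [SimpleGraph.Walk.edges_mapLe_eq_edges, SimpleGraph.Walk.edges_mapLe_eq_edges] at heq2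
  cases p with
  | nil => rfl
  | @cons _ w _ h r =>
    exfalso
    have hm := (q.edges_subset_edgeSet (heq2 ▸ (by simp : s(x, w) ∈ (SimpleGraph.Walk.cons h r).edges)))
    rw [SimpleGraph.mem_edgeSet, SimpleGraph.fromEdgeSet_adj] at hm
    rw [SimpleGraph.fromEdgeSet_adj] at h
    exact hd _ h.1 hm.1

/-- The parent function of the minimum spanning tree. -/
noncomputable def parFn (G : SimpleGraph V) (v0 v1 v2 : V) (u : V) : V :=
  if G.Adj v0 u then v0 else if G.Adj v1 u then v1 else v2

/-- The explicit description of the minimum spanning tree. -/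
def coneTree (G : SimpleGraph V) (v0 v1 v2 : V) : Set (Sym2 V) :=
  {e | ∃ u, u ≠ v0 ∧ e = s(u, parFn G v0 v1 v2 u)}

/-- The facts about the minimum spanning tree that are used below. -/
structure ParSpec (G : SimpleGraph V) (v0 v1 v2 : V) (B0 : Set (Sym2 V)) (par : V → V) :
    Prop where
  n01 : v0 ≠ v1
  n02 : v0 ≠ v2
  n12 : v1 ≠ v2
  mem : ∀ a b, s(a, b) ∈ B0 ↔ (a ≠ v0 ∧ par a = b) ∨ (b ≠ v0 ∧ par b = a)
  child : ∀ u p, IsChildOf B0 v0 u p ↔ u ≠ v0 ∧ par u = p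
  rng : ∀ u, par u = v0 ∨ par u = v1 ∨ par u = v2
  p1 : par v1 = v0
  p2 : par v2 = v0
  v0edge : ∀ x, G.Adj v0 x → s(v0, x) ∈ B0

theorem coneTree_adj {G : SimpleGraph V} {v0 v1 v2 : V} (hG : IsTriconed G v0 v1 v2)
    {u : V} (hu : u ≠ v0) : G.Adj u (parFn G v0 v1 v2 u) := by
  obtain ⟨_, _, _, _, h01, h02, hall⟩ := hG
  unfold parFn
  split_ifs with h1 h2
  · exact h1.symm
  · exact h2.symm
  · rcases hall u hu (by rintro rfl; exact h1 h01) (by rintro rfl; exact h1 h02) with h | h | h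
    · exact absurd h h1
    · exact absurd h h2
    · exact h.symm

theorem parFn_v0 {G : SimpleGraph V} {v0 v1 v2 u : V} (h : G.Adj v0 u) :
    parFn G v0 v1 v2 u = v0 := by simp [parFn, h]

theorem parFn_rng (G : SimpleGraph V) (v0 v1 v2 u : V) :
    parFn G v0 v1 v2 u = v0 ∨ parFn G v0 v1 v2 u = v1 ∨ parFn G v0 v1 v2 u = v2 := by
  unfold parFn; split_ifs <;> simp

theorem coneTree_isSpanningTree {G : SimpleGraph V} {v0 v1 v2 : V}
    (hG : IsTriconed G v0 v1 v2) : IsSpanningTree G (coneTree G v0 v1 v2) := by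
  have hsub : coneTree G v0 v1 v2 ⊆ G.edgeSet := by
    rintro e ⟨u, hu, rfl⟩
    exact coneTree_adj hG hu
  refine ⟨hsub, ?_⟩
  have hadj : ∀ u, u ≠ v0 →
      (SimpleGraph.fromEdgeSet (coneTree G v0 v1 v2)).Adj u (parFn G v0 v1 v2 u) := by
    intro u hu
    rw [SimpleGraph.fromEdgeSet_adj]
    exact ⟨⟨u, hu, rfl⟩, (coneTree_adj hG hu).ne⟩
  have hreach : ∀ u, (SimpleGraph.fromEdgeSet (coneTree G v0 v1 v2)).Reachable u v0 := by
    have h1 := hadj v1 hG.2.1.symm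
    have h2 := hadj v2 hG.2.2.1.symm
    rw [parFn_v0 hG.2.2.2.2.1] at h1
    rw [parFn_v0 hG.2.2.2.2.2.1] at h2
    intro u
    by_cases hu : u = v0
    · rw [hu]
    · have h := hadj u hu
      rcases parFn_rng G v0 v1 v2 u with h' | h' | h' <;> rw [h'] at h
      · exact h.reachable
      · exact h.reachable.trans h1.reachable
      · exact h.reachable.trans h2.reachable
  have hconn : (SimpleGraph.fromEdgeSet (coneTree G v0 v1 v2)).Connected := by
    haveI : Nonempty V := ⟨v0⟩
    exact ⟨fun a b => (hreach a).trans (hreach b).symm⟩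
  rw [SimpleGraph.isTree_iff_connected_and_card]
  refine ⟨hconn, le_antisymm ?_ hconn.card_vert_le_card_edgeSet_add_one⟩
  have hle : Nat.card (SimpleGraph.fromEdgeSet (coneTree G v0 v1 v2)).edgeSet
      ≤ Nat.card ({v0}ᶜ : Set V) := by
    rw [Nat.card_coe_set_eq, Nat.card_coe_set_eq]
    refine le_trans (Set.ncard_le_ncard (t := (fun u => s(u, parFn G v0 v1 v2 u)) '' {v0}ᶜ) ?_
      (Set.toFinite _)) (Set.ncard_image_le (Set.toFinite _))
    intro e he
    rw [SimpleGraph.edgeSet_fromEdgeSet] at he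
    obtain ⟨u, hu, rfl⟩ := he.1
    exact ⟨u, hu, rfl⟩
  rw [Nat.card_coe_set_eq ({v0}ᶜ : Set V)] at hle
  have := Set.ncard_add_ncard_compl ({v0} : Set V)
  rw [Set.ncard_singleton] at this
  omega

theorem coneTree_block {G : SimpleGraph V} {v0 v1 v2 : V}
    (hG : IsTriconed G v0 v1 v2) {e : Sym2 V} (he : e ∈ G.edgeSet) :
    e ∈ coneTree G v0 v1 v2 ↔ edgeBlock G v0 v1 v2 e ≤ 2 := by
  constructor
  · rintro ⟨u, hu, rfl⟩
    unfold edgeBlock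
    split_ifs with h1 h2 h3
    · omega
    · omega
    · omega
    · exfalso
      have hadj := coneTree_adj hG hu
      unfold parFn at *
      split_ifs at * with k1 k2
      · exact h1 (by simp)
      · exact h2 ⟨u, Sym2.eq_swap, k1⟩
      · exact h3 ⟨u, Sym2.eq_swap, k1, k2⟩
  · intro h
    unfold edgeBlock at h
    split_ifs at h with h1 h2 h3
    · obtain ⟨x, rfl⟩ := Sym2.mem_iff_exists.mp h1
      have hx : G.Adj v0 x := he
      exact ⟨x, hx.ne', by rw [parFn_v0 hx, Sym2.eq_swap]⟩
    · obtain ⟨x, rfl, hx⟩ := h2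
      have hx1 : G.Adj v1 x := he
      exact ⟨x, by rintro rfl; simp at h1, by simp [parFn, hx, hx1, Sym2.eq_swap]⟩
    · obtain ⟨x, rfl, hx, hx1⟩ := h3
      exact ⟨x, by rintro rfl; simp at h1, by simp [parFn, hx, hx1, Sym2.eq_swap]⟩
    · omega

theorem minTree_eq {G : SimpleGraph V} {v0 v1 v2 : V} {B0 : Set (Sym2 V)}
    (hG : IsTriconed G v0 v1 v2) (heo : EdgeOrderSpec G v0 v1 v2)
    (hB0 : IsMinSpanningTree G B0) : B0 = coneTree G v0 v1 v2 := by
  have hT := coneTree_isSpanningTree hG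
  by_contra hne
  obtain ⟨e, he, heT, hmin⟩ := hB0.2 _ hT (Ne.symm hne)
  have hex : ∃ f ∈ coneTree G v0 v1 v2, f ∉ B0 := by
    by_contra hcon
    push Not at hcon
    induction e using Sym2.ind with
    | _ a b =>
      have hab : G.Adj a b := hB0.1.1 he
      refine hab.ne (key_disjoint hB0.1.2.isAcyclic (X := {s(a, b)})
        (by simpa using he) hcon (by rintro f rfl; exact heT) ?_
        (hT.2.connected.preconnected a b))
      exact SimpleGraph.Adj.reachable (by simp [hab.ne])
  obtain ⟨f, hf, hfB⟩ := hex
  have hlt := hmin f (Or.inr ⟨hf, hfB⟩) (by rintro rfl; exact hfB he)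
  have h1 := (coneTree_block hG (hT.1 hf)).1 hf
  have h2 : ¬ _ := fun h => heT ((coneTree_block hG (hB0.1.1 he)).2 h)
  exact lt_asymm hlt (heo.1 f (hT.1 hf) e (hB0.1.1 he) (by omega))

theorem parSpec_of_min {G : SimpleGraph V} {v0 v1 v2 : V} {B0 : Set (Sym2 V)}
    (hG : IsTriconed G v0 v1 v2) (heo : EdgeOrderSpec G v0 v1 v2)
    (hB0 : IsMinSpanningTree G B0) : ParSpec G v0 v1 v2 B0 (parFn G v0 v1 v2) := by
  have hB := minTree_eq hG heo hB0
  have p1 : parFn G v0 v1 v2 v1 = v0 := parFn_v0 hG.2.2.2.2.1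
  have p2 : parFn G v0 v1 v2 v2 = v0 := parFn_v0 hG.2.2.2.2.2.1
  have hmem : ∀ a b, s(a, b) ∈ B0 ↔ (a ≠ v0 ∧ parFn G v0 v1 v2 a = b) ∨
      (b ≠ v0 ∧ parFn G v0 v1 v2 b = a) := by
    intro a b
    rw [hB]
    constructor
    · rintro ⟨u, hu, h⟩
      rw [Sym2.eq_iff] at h
      rcases h with ⟨rfl, h⟩ | ⟨h, rfl⟩
      · exact Or.inl ⟨hu, h.symm⟩
      · exact Or.inr ⟨hu, h.symm⟩
    · rintro (⟨h, rfl⟩ | ⟨h, rfl⟩)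
      · exact ⟨a, h, rfl⟩
      · exact ⟨b, h, Sym2.eq_swap⟩
  -- special vertices reach the root without a given other edge
  have hroot : ∀ q e, q ≠ v0 → parFn G v0 v1 v2 q = v0 → e ≠ s(q, v0) →
      (SimpleGraph.fromEdgeSet (B0 \ {e})).Reachable q v0 := by
    intro q e hq hp he
    apply SimpleGraph.Adj.reachable
    rw [SimpleGraph.fromEdgeSet_adj]
    exact ⟨⟨(hmem _ _).2 (Or.inl ⟨hq, hp⟩), fun h => he h.symm⟩, hq⟩
  have hrootp : ∀ u e, parFn G v0 v1 v2 u ≠ v0 → e ≠ s(parFn G v0 v1 v2 u, v0) →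
      (SimpleGraph.fromEdgeSet (B0 \ {e})).Reachable (parFn G v0 v1 v2 u) v0 := by
    intro u e h he
    refine hroot _ _ h ?_ he
    rcases parFn_rng G v0 v1 v2 u with h' | h' | h'
    · exact absurd h' h
    · rw [h', p1]
    · rw [h', p2]
  refine ⟨hG.2.1, hG.2.2.1, hG.2.2.2.1, hmem, ?_, parFn_rng G v0 v1 v2, p1, p2, ?_⟩
  · intro u p
    constructor
    · rintro ⟨h1, h2⟩
      have hu : u ≠ v0 := by rintro rfl; exact h2 (SimpleGraph.Reachable.refl _)
      rcases (hmem _ _).1 h1 with h | ⟨h, rfl⟩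
      · exact h
      · refine absurd (hrootp p _ hu ?_) h2
        intro h'
        rw [Sym2.eq_iff] at h'
        rcases h' with ⟨_, h'⟩ | ⟨h', _⟩
        · exact h h'
        · exact hu h'
    · rintro ⟨hu, rfl⟩
      have hm : s(u, parFn G v0 v1 v2 u) ∈ B0 := (hmem _ _).2 (Or.inl ⟨hu, rfl⟩)
      refine ⟨hm, fun hr => ?_⟩
      have hadj := coneTree_adj hG hu
      have hr2 : (SimpleGraph.fromEdgeSet (B0 \ {s(u, parFn G v0 v1 v2 u)})).Reachable
          u (parFn G v0 v1 v2 u) := by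
        by_cases hp : parFn G v0 v1 v2 u = v0
        · rw [hp] at hr ⊢; exact hr
        · refine hr.trans (hrootp u _ hp ?_).symm
          intro h'
          rw [Sym2.eq_iff] at h'
          rcases h' with ⟨_, h'⟩ | ⟨h', _⟩
          · exact hp h'
          · exact hu h'
      refine hadj.ne (key_disjoint hB0.1.2.isAcyclic (X := {s(u, parFn G v0 v1 v2 u)})
        (by simpa using hm) Set.sdiff_subset (by rintro f rfl; simp) ?_ hr2)
      exact SimpleGraph.Adj.reachable (by simp [hadj.ne])
  · intro x hx
    exact (hmem _ _).2 (Or.inr ⟨hx.ne', parFn_v0 hx⟩)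

/-- The three blueprint vertices as vertices of `G`. -/
def rootV (v0 v1 v2 : V) (t : ℕ) : V := if t = 1 then v1 else if t = 2 then v2 else v0

/-- `x` carries a mark of type `t`. -/
def HasMark (B0 : Set (Sym2 V)) (v0 v1 v2 : V) (m : V → ℕ) (t : ℕ) (x : V) : Prop :=
  (1 ≤ m x ∧ vType B0 v0 v1 v2 x = t) ∨ (m x = 2 ∧ t = 0)

section Aux

variable {G : SimpleGraph V} {v0 v1 v2 : V} {B0 B E : Set (Sym2 V)} {par : V → V} {m : V → ℕ}

theorem vType_eq (hP : ParSpec G v0 v1 v2 B0 par) (x : V) :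
    vType B0 v0 v1 v2 x = if x = v1 ∨ (x ≠ v0 ∧ par x = v1) then 1
      else if x = v2 ∨ (x ≠ v0 ∧ par x = v2) then 2 else 0 := by
  simp only [vType, hP.child]

theorem marked_iff (hP : ParSpec G v0 v1 v2 B0 par) (hphi : IsPhi1 G v0 v1 v2 B0 B E m) (x : V) :
    1 ≤ m x ↔ x = v1 ∨ x = v2 ∨ (x ≠ v0 ∧ s(x, par x) ∈ B) := by
  rw [hphi.2.2.1 x]
  simp only [hP.child]
  constructor
  · rintro (h | h | ⟨p, ⟨h1, rfl⟩, h2⟩)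
    · exact Or.inl h
    · exact Or.inr (Or.inl h)
    · exact Or.inr (Or.inr ⟨h1, h2⟩)
  · rintro (h | h | ⟨h1, h2⟩)
    · exact Or.inl h
    · exact Or.inr (Or.inl h)
    · exact Or.inr (Or.inr ⟨_, ⟨h1, rfl⟩, h2⟩)

/-- Edges of `B` outside `B0` are edges of `E`. -/
theorem mem_E (hP : ParSpec G v0 v1 v2 B0 par) (hB : IsSpanningTree G B)
    (hphi : IsPhi1 G v0 v1 v2 B0 B E m) {a b : V} (h : s(a, b) ∈ B) (h0 : s(a, b) ∉ B0) :
    s(a, b) ∈ E ∧ a ≠ v0 ∧ b ≠ v0 := by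
  have hadj : G.Adj a b := hB.1 h
  have ha : a ≠ v0 := by rintro rfl; exact h0 (hP.v0edge _ hadj)
  have hb : b ≠ v0 := by
    rintro rfl; exact h0 (by rw [Sym2.eq_swap]; exact hP.v0edge _ hadj.symm)
  refine ⟨?_, ha, hb⟩
  rw [hphi.1]
  refine ⟨h, hadj, h0, ?_⟩
  rw [Sym2.mem_iff]
  rintro (h | h)
  · exact ha h.symm
  · exact hb h.symm

/-- Following a walk of `B` one meets a marked vertex in the starting component. -/
theorem hit (hP : ParSpec G v0 v1 v2 B0 par) (hB : IsSpanningTree G B)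
    (hphi : IsPhi1 G v0 v1 v2 B0 B E m) {a z : V} (r : (SimpleGraph.fromEdgeSet B).Walk a z)
    (ha : a ≠ v0) (hz : z = v0 ∨ 1 ≤ m z) :
    ∃ x ∈ r.support, (SimpleGraph.fromEdgeSet E).Reachable a x ∧ 1 ≤ m x := by
  induction r with
  | nil => exact ⟨_, by simp, SimpleGraph.Reachable.refl _, hz.resolve_left ha⟩
  | @cons a b c h r ih =>
    rw [SimpleGraph.fromEdgeSet_adj] at h
    by_cases h0 : s(a, b) ∈ B0
    · refine ⟨a, by simp, SimpleGraph.Reachable.refl _, ?_⟩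
      rw [marked_iff hP hphi]
      rcases (hP.mem _ _).1 h0 with ⟨_, rfl⟩ | ⟨hb, h'⟩
      · exact Or.inr (Or.inr ⟨ha, h.1⟩)
      · rcases hP.rng b with k | k | k
        · exact absurd (h'.symm.trans k) ha
        · exact Or.inl (h'.symm.trans k)
        · exact Or.inr (Or.inl (h'.symm.trans k))
    · obtain ⟨hE, _, hb⟩ := mem_E hP hB hphi h.1 h0
      obtain ⟨x, hx, hr, hm⟩ := ih hb hz
      refine ⟨x, by simp [hx], ?_, hm⟩
      refine SimpleGraph.Reachable.trans (SimpleGraph.Adj.reachable ?_) hr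
      rw [SimpleGraph.fromEdgeSet_adj]
      exact ⟨hE, h.2⟩

theorem hit_other (hP : ParSpec G v0 v1 v2 B0 par) (hB : IsSpanningTree G B)
    (hphi : IsPhi1 G v0 v1 v2 B0 B E m) {a z : V} (r : (SimpleGraph.fromEdgeSet B).Walk a z)
    (hr : r.IsPath) (hz : z = v0 ∨ 1 ≤ m z) (i : ℕ) (e : Sym2 V)
    (he : r.edges[i]? = some e) (he0 : e ∉ B0) :
    ∃ x, (SimpleGraph.fromEdgeSet E).Reachable (r.getVert i) x ∧ x ≠ r.getVert i ∧ 1 ≤ m x := by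
  induction r generalizing i with
  | nil => simp at he
  | @cons a b c h r ih =>
    rw [SimpleGraph.Walk.cons_isPath_iff] at hr
    cases i with
    | zero =>
      rw [SimpleGraph.fromEdgeSet_adj] at h
      simp only [SimpleGraph.Walk.edges_cons, List.getElem?_cons_zero, Option.some.injEq] at he
      subst he
      obtain ⟨hE, _, hb⟩ := mem_E hP hB hphi h.1 he0
      obtain ⟨x, hx, hr', hm⟩ := hit hP hB hphi r hb hz
      rw [SimpleGraph.Walk.getVert_zero]
      refine ⟨x, ?_, ?_, hm⟩
      · refine SimpleGraph.Reachable.trans (SimpleGraph.Adj.reachable ?_) hr'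
        rw [SimpleGraph.fromEdgeSet_adj]
        exact ⟨hE, h.2⟩
      · rintro rfl
        exact hr.2 hx
    | succ i =>
      rw [SimpleGraph.Walk.getVert_cons_succ]
      exact ih hr.1 hz i (by simpa using he)

/-- The vertex carrying the extra mark is `v2` or a child of `v2` attached to it in `B`. -/
theorem doubly_spec (hP : ParSpec G v0 v1 v2 B0 par)
    {v : V} (h : DoublyMarkedAt B0 B v0 v1 v2 v) :
    s(v0, v2) ∈ B ∧ (v = v2 ∨ (v ≠ v0 ∧ v ≠ v1 ∧ par v = v2 ∧ s(v, v2) ∈ B)) := by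
  obtain ⟨h02, p, hp, hnot, i, hlt, ⟨e, he, he0⟩, rfl⟩ := h
  refine ⟨h02, ?_⟩
  cases p with
  | nil => simp at he
  | @cons _ w _ h q =>
    cases i with
    | zero => left; simp
    | succ i =>
      right
      rw [SimpleGraph.Walk.getVert_cons_succ]
      have h0 : s(v2, w) ∈ B0 := hlt 0 (by omega) _ (by simp)
      rw [SimpleGraph.fromEdgeSet_adj] at h
      have hw0 : w ≠ v0 := by
        rintro rfl
        exact hnot (by simp [Sym2.eq_swap])
      have hpw : par w = v2 := by
        rcases (hP.mem _ _).1 h0 with ⟨_, k⟩ | ⟨_, k⟩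
        · exact absurd (k.symm.trans hP.p2) hw0
        · exact k
      have hw1 : w ≠ v1 := by
        rintro rfl
        exact hP.n02 (hP.p1.symm.trans hpw)
      have hw2 : w ≠ v2 := h.2.symm
      cases q with
      | nil => exact absurd rfl hw1
      | @cons _ w' _ h' q' =>
        cases i with
        | zero =>
          rw [SimpleGraph.Walk.getVert_zero]
          exact ⟨hw0, hw1, hpw, by rw [Sym2.eq_swap]; exact h.1⟩
        | succ i =>
          exfalso
          have h1 : s(w, w') ∈ B0 := hlt 1 (by omega) _ (by simp)
          have hw' : w' = v2 := by
            rcases (hP.mem _ _).1 h1 with ⟨_, k⟩ | ⟨_, k⟩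
            · exact k.symm.trans hpw
            · rcases hP.rng w' with k' | k' | k'
              · exact absurd (k.symm.trans k') hw0
              · exact absurd (k.symm.trans k') hw1
              · exact absurd (k.symm.trans k') hw2
          subst hw'
          rw [SimpleGraph.Walk.cons_isPath_iff] at hp
          exact hp.2 (by simp)

theorem doubly_other (hP : ParSpec G v0 v1 v2 B0 par) (hB : IsSpanningTree G B)
    (hphi : IsPhi1 G v0 v1 v2 B0 B E m) {v : V} (h : m v = 2) :
    ∃ x, (SimpleGraph.fromEdgeSet E).Reachable v x ∧ x ≠ v ∧ 1 ≤ m x := by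
  obtain ⟨_, p, hp, _, i, _, ⟨e, he, he0⟩, rfl⟩ := (hphi.2.2.2 v).1 h
  exact hit_other hP hB hphi p hp (Or.inr ((marked_iff hP hphi v1).2 (Or.inl rfl))) i e he he0

theorem doubly_type (hP : ParSpec G v0 v1 v2 B0 par)
    (hphi : IsPhi1 G v0 v1 v2 B0 B E m) {v : V} (h : m v = 2) : vType B0 v0 v1 v2 v = 2 := by
  obtain ⟨_, h⟩ := doubly_spec hP ((hphi.2.2.2 v).1 h)
  rw [vType_eq hP]
  have n12 := hP.n12
  have n02 := hP.n02
  have n01 := hP.n01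
  have p2 := hP.p2
  rcases h with rfl | ⟨h0, h1, h2, _⟩
  · rw [if_neg, if_pos (Or.inl rfl)]
    rintro (h | ⟨_, h⟩)
    · exact n12 h.symm
    · exact n01 (p2.symm.trans h)
  · rw [if_neg, if_pos (Or.inr ⟨h0, h2⟩)]
    rintro (h | ⟨_, h⟩)
    · exact h1 h
    · exact n12 (h.symm.trans h2)

/-- `B` with the edges of the component of `u` removed. -/
def cutGraph (B E : Set (Sym2 V)) (u : V) : SimpleGraph V :=
  SimpleGraph.fromEdgeSet (B \ compEdges E u)

theorem cut_base (hphi : IsPhi1 G v0 v1 v2 B0 B E m) (u : V) {a b : V} (h : s(a, b) ∈ B)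
    (h0 : s(a, b) ∈ B0) : (cutGraph B E u).Reachable a b := by
  by_cases hab : a = b
  · rw [hab]
  · apply SimpleGraph.Adj.reachable
    unfold cutGraph
    rw [SimpleGraph.fromEdgeSet_adj]
    refine ⟨⟨h, fun hc => ?_⟩, hab⟩
    have := hc.1
    rw [hphi.1] at this
    exact this.2.2.1 h0

theorem cut_mark (hP : ParSpec G v0 v1 v2 B0 par) (hphi : IsPhi1 G v0 v1 v2 B0 B E m) (u : V)
    {t : ℕ} {x : V} (h : HasMark B0 v0 v1 v2 m t x) :
    (cutGraph B E u).Reachable x (rootV v0 v1 v2 t) := by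
  have hpar : ∀ x, x ≠ v0 → s(x, par x) ∈ B → (cutGraph B E u).Reachable x (par x) :=
    fun x hx hm => cut_base hphi u hm ((hP.mem _ _).2 (Or.inl ⟨hx, rfl⟩))
  have n12 := hP.n12
  have n02 := hP.n02
  have n01 := hP.n01
  have p2 := hP.p2
  have p1 := hP.p1
  rcases h with ⟨hm, ht⟩ | ⟨hm, rfl⟩
  · rw [marked_iff hP hphi] at hm
    rw [vType_eq hP] at ht
    split_ifs at ht with h1 h2
    · subst ht
      simp only [rootV, if_true]
      rcases h1 with rfl | ⟨h1, h1'⟩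
      · exact SimpleGraph.Reachable.refl _
      · rcases hm with rfl | rfl | ⟨k, k'⟩
        · exact SimpleGraph.Reachable.refl _
        · exact absurd (p2.symm.trans h1') n01
        · have := hpar x k k'
          rwa [h1'] at this
    · subst ht
      simp only [rootV]
      rcases h2 with rfl | ⟨h2, h2'⟩
      · exact SimpleGraph.Reachable.refl _
      · rcases hm with rfl | rfl | ⟨k, k'⟩
        · exact absurd (Or.inl rfl) h1
        · exact SimpleGraph.Reachable.refl _
        · have := hpar x k k'
          rwa [h2'] at this
    · subst ht
      simp only [rootV]
      rcases hm with rfl | rfl | ⟨k, k'⟩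
      · exact absurd (Or.inl rfl) h1
      · exact absurd (Or.inl rfl) h2
      · have := hpar x k k'
        rcases hP.rng x with r | r | r
        · rwa [r] at this
        · exact absurd (Or.inr ⟨k, r⟩) h1
        · exact absurd (Or.inr ⟨k, r⟩) h2
  · obtain ⟨h02, h⟩ := doubly_spec hP ((hphi.2.2.2 x).1 hm)
    have h20 : (cutGraph B E u).Reachable v2 v0 := by
      have := hpar v2 n02.symm (by rw [p2, Sym2.eq_swap]; exact h02)
      rwa [p2] at this
    simp only [rootV]
    rcases h with rfl | ⟨k0, _, k2, k⟩
    · exact h20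
    · have := hpar x k0 (by rw [k2]; exact k)
      rw [k2] at this
      exact this.trans h20

theorem cut_outside (hphi : IsPhi1 G v0 v1 v2 B0 B E m) {u a b : V}
    (hu : ¬(SimpleGraph.fromEdgeSet E).Reachable u a)
    (h : (SimpleGraph.fromEdgeSet E).Reachable a b) : (cutGraph B E u).Reachable a b := by
  obtain ⟨p⟩ := h
  induction p with
  | nil => exact SimpleGraph.Reachable.refl _
  | @cons a c d h p ih =>
    have hc : ¬(SimpleGraph.fromEdgeSet E).Reachable u c :=
      fun hc => hu (hc.trans h.symm.reachable)
    refine SimpleGraph.Reachable.trans (SimpleGraph.Adj.reachable ?_) (ih hc)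
    rw [SimpleGraph.fromEdgeSet_adj] at h
    unfold cutGraph
    rw [SimpleGraph.fromEdgeSet_adj]
    have hB : s(a, c) ∈ B := by
      have := h.1
      rw [hphi.1] at this
      exact this.1
    exact ⟨⟨hB, fun hk => hu (hk.2 a (by simp))⟩, h.2⟩

theorem inside_reach {u a b : V} (hu : (SimpleGraph.fromEdgeSet E).Reachable u a)
    (h : (SimpleGraph.fromEdgeSet E).Reachable a b) :
    (SimpleGraph.fromEdgeSet (compEdges E u)).Reachable a b := by
  obtain ⟨p⟩ := h
  induction p with
  | nil => exact SimpleGraph.Reachable.refl _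
  | @cons a c d h p ih =>
    have hc : (SimpleGraph.fromEdgeSet E).Reachable u c := hu.trans h.reachable
    refine SimpleGraph.Reachable.trans (SimpleGraph.Adj.reachable ?_) (ih hc)
    rw [SimpleGraph.fromEdgeSet_adj] at h ⊢
    refine ⟨⟨h.1, ?_⟩, h.2⟩
    intro x hx
    rw [Sym2.mem_iff] at hx
    rcases hx with rfl | rfl
    · exact hu
    · exact hc

/-- The central separation property: distinct vertices of the component of `u` are
separated once the edges of this component are removed from `B`. -/
theorem cut_inside (hB : IsSpanningTree G B) (hphi : IsPhi1 G v0 v1 v2 B0 B E m) {u x y : V}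
    (hx : (SimpleGraph.fromEdgeSet E).Reachable u x)
    (hy : (SimpleGraph.fromEdgeSet E).Reachable u y)
    (h : (cutGraph B E u).Reachable x y) : x = y := by
  refine key_disjoint hB.2.isAcyclic (X := compEdges E u) (Y := B \ compEdges E u) ?_
    Set.sdiff_subset (fun e he he' => he'.2 he) (inside_reach hx (hx.symm.trans hy)) h
  intro e he
  have := he.1
  rw [hphi.1] at this
  exact this.1

theorem markType_exists {u : V} {t : ℕ} (h : 1 ≤ markTypeCount B0 v0 v1 v2 E m u t) :
    ∃ x, (SimpleGraph.fromEdgeSet E).Reachable u x ∧ HasMark B0 v0 v1 v2 m t x := by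
  unfold markTypeCount at h
  obtain ⟨x, _, hx⟩ := Finset.exists_ne_zero_of_sum_ne_zero (Nat.one_le_iff_ne_zero.1 h)
  refine ⟨x, ?_⟩
  unfold HasMark
  by_contra hcon
  apply hx
  split_ifs <;> first | rfl | (exfalso; tauto)

theorem markType_le (hP : ParSpec G v0 v1 v2 B0 par) (hB : IsSpanningTree G B)
    (hphi : IsPhi1 G v0 v1 v2 B0 B E m) (u : V) (t : ℕ) :
    markTypeCount B0 v0 v1 v2 E m u t ≤ 1 := by
  by_contra hcon
  obtain ⟨x, hx, hmx⟩ := markType_exists (B0 := B0) (v0 := v0) (v1 := v1) (v2 := v2)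
    (E := E) (m := m) (u := u) (t := t) (by omega)
  apply hcon
  unfold markTypeCount
  rw [Finset.sum_eq_single x]
  · have := doubly_type hP hphi (v := x)
    rw [if_pos hx]
    split_ifs with h1 h2 h2
    · have h3 := this h2.1
      rw [h1.2, h2.2] at h3
      omega
    all_goals omega
  · intro y _ hyx
    by_cases hy : (SimpleGraph.fromEdgeSet E).Reachable u y
    · have hn : ¬ HasMark B0 v0 v1 v2 m t y := by
        intro hmy
        exact hyx (cut_inside hB hphi hy hx
          ((cut_mark hP hphi u hmy).trans (cut_mark hP hphi u hmx).symm))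
      unfold HasMark at hn
      push Not at hn
      rw [if_pos hy, if_neg (fun h => hn.1 h.1 h.2), if_neg (fun h => hn.2 h.1 h.2), add_zero]
    · rw [if_neg hy]
  · intro h
    exact absurd (Finset.mem_univ x) h

theorem compMarks_eq (hP : ParSpec G v0 v1 v2 B0 par)
    (hphi : IsPhi1 G v0 v1 v2 B0 B E m) (u : V) :
    compMarks E m u = markTypeCount B0 v0 v1 v2 E m u 0 + markTypeCount B0 v0 v1 v2 E m u 1
      + markTypeCount B0 v0 v1 v2 E m u 2 := by
  unfold compMarks markTypeCount
  rw [← Finset.sum_add_distrib, ← Finset.sum_add_distrib]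
  refine Finset.sum_congr rfl fun x _ => ?_
  have h2 := hphi.2.1 x
  have ht : vType B0 v0 v1 v2 x = 0 ∨ vType B0 v0 v1 v2 x = 1 ∨ vType B0 v0 v1 v2 x = 2 := by
    unfold vType; split_ifs <;> simp
  by_cases hr : (SimpleGraph.fromEdgeSet E).Reachable u x
  · simp only [if_pos hr]
    have hm : m x = 0 ∨ m x = 1 ∨ m x = 2 := by omega
    rcases hm with hm | hm | hm <;> rcases ht with ht | ht | ht <;> simp [hm, ht]
  · simp [if_neg hr]

theorem le_compMarks {u x y : V} (hx : (SimpleGraph.fromEdgeSet E).Reachable u x)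
    (hy : (SimpleGraph.fromEdgeSet E).Reachable u y) (hxy : x ≠ y) :
    m x + m y ≤ compMarks E m u := by
  unfold compMarks
  calc m x + m y = ∑ z ∈ {x, y}, if (SimpleGraph.fromEdgeSet E).Reachable u z then m z else 0 := by
        rw [Finset.sum_pair hxy, if_pos hx, if_pos hy]
    _ ≤ _ := Finset.sum_le_sum_of_subset (Finset.subset_univ _)

/-- The component of `u` carries marks of types `a` and `b`. -/
def WeakLink (B0 : Set (Sym2 V)) (v0 v1 v2 : V) (E : Set (Sym2 V)) (m : V → ℕ)
    (u : V) (a b : ℕ) : Prop :=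
  ∃ x y, (SimpleGraph.fromEdgeSet E).Reachable u x ∧ (SimpleGraph.fromEdgeSet E).Reachable u y ∧
    HasMark B0 v0 v1 v2 m a x ∧ HasMark B0 v0 v1 v2 m b y

/-- The component of `u` carries marks of types `a` and `b` at different vertices. -/
def StrongLink (B0 : Set (Sym2 V)) (v0 v1 v2 : V) (E : Set (Sym2 V)) (m : V → ℕ)
    (u : V) (a b : ℕ) : Prop :=
  ∃ x y, x ≠ y ∧ (SimpleGraph.fromEdgeSet E).Reachable u x ∧
    (SimpleGraph.fromEdgeSet E).Reachable u y ∧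
    HasMark B0 v0 v1 v2 m a x ∧ HasMark B0 v0 v1 v2 m b y

theorem StrongLink.weak {u : V} {a b : ℕ} (h : StrongLink B0 v0 v1 v2 E m u a b) :
    WeakLink B0 v0 v1 v2 E m u a b := by
  obtain ⟨x, y, _, h⟩ := h
  exact ⟨x, y, h⟩

theorem strong_sep (hP : ParSpec G v0 v1 v2 B0 par) (hB : IsSpanningTree G B)
    (hphi : IsPhi1 G v0 v1 v2 B0 B E m) {u : V} {a b : ℕ}
    (h : StrongLink B0 v0 v1 v2 E m u a b) :
    ¬(cutGraph B E u).Reachable (rootV v0 v1 v2 a) (rootV v0 v1 v2 b) := by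
  obtain ⟨x, y, hne, hx, hy, ha, hb⟩ := h
  intro hr
  exact hne (cut_inside hB hphi hx hy
    (((cut_mark hP hphi u ha).trans hr).trans (cut_mark hP hphi u hb).symm))

theorem weak_link (hP : ParSpec G v0 v1 v2 B0 par)
    (hphi : IsPhi1 G v0 v1 v2 B0 B E m) {u u' : V} {a b : ℕ}
    (hu : ¬(SimpleGraph.fromEdgeSet E).Reachable u u')
    (h : WeakLink B0 v0 v1 v2 E m u' a b) :
    (cutGraph B E u).Reachable (rootV v0 v1 v2 a) (rootV v0 v1 v2 b) := by
  obtain ⟨x, y, hx, hy, ha, hb⟩ := h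
  exact ((cut_mark hP hphi u ha).symm.trans
    ((cut_outside hphi hu hx).symm.trans (cut_outside hphi hu hy))).trans (cut_mark hP hphi u hb)

theorem strong_of_two (hP : ParSpec G v0 v1 v2 B0 par) (hB : IsSpanningTree G B)
    (hphi : IsPhi1 G v0 v1 v2 B0 B E m) {u : V} {a b : ℕ} (hc : compMarks E m u = 2)
    (hab : a ≠ b) (ha : 1 ≤ markTypeCount B0 v0 v1 v2 E m u a)
    (hb : 1 ≤ markTypeCount B0 v0 v1 v2 E m u b) : StrongLink B0 v0 v1 v2 E m u a b := by
  obtain ⟨x, hx, hmx⟩ := markType_exists ha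
  obtain ⟨y, hy, hmy⟩ := markType_exists hb
  refine ⟨x, y, ?_, hx, hy, hmx, hmy⟩
  rintro rfl
  have h2 : m x = 2 := by
    rcases hmx with h | h
    · rcases hmy with h' | h'
      · exact absurd (h.2.symm.trans h'.2) hab
      · exact h'.1
    · exact h.1
  obtain ⟨z, hz, hzx, hmz⟩ := doubly_other hP hB hphi h2
  have := le_compMarks (m := m) hx (hx.trans hz) hzx.symm
  omega

theorem strong_of_three (hP : ParSpec G v0 v1 v2 B0 par) (hB : IsSpanningTree G B)
    (hphi : IsPhi1 G v0 v1 v2 B0 B E m) {u : V} (hc : compMarks E m u = 3) :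
    StrongLink B0 v0 v1 v2 E m u 0 1 ∧ WeakLink B0 v0 v1 v2 E m u 0 2 := by
  have h := compMarks_eq hP hphi u
  have h0 := markType_le hP hB hphi u 0
  have h1 := markType_le hP hB hphi u 1
  have h2 := markType_le hP hB hphi u 2
  obtain ⟨x, hx, hmx⟩ := markType_exists (by omega : 1 ≤ markTypeCount B0 v0 v1 v2 E m u 0)
  obtain ⟨y, hy, hmy⟩ := markType_exists (by omega : 1 ≤ markTypeCount B0 v0 v1 v2 E m u 1)
  obtain ⟨z, hz, hmz⟩ := markType_exists (by omega : 1 ≤ markTypeCount B0 v0 v1 v2 E m u 2)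
  refine ⟨⟨x, y, ?_, hx, hy, hmx, hmy⟩, x, z, hx, hz, hmx, hmz⟩
  rintro rfl
  have hy1 : vType B0 v0 v1 v2 x = 1 := by
    rcases hmy with h | h
    · exact h.2
    · omega
  rcases hmx with h | h
  · omega
  · have := doubly_type hP hphi h.1
    omega

theorem pair01 : ¬(({1, 2} : Set ℕ) = {0, 1} ∨ ({1, 2} : Set ℕ) = {0, 2}) := by
  rintro (h | h)
  · have : (0 : ℕ) ∈ ({1, 2} : Set ℕ) := by rw [h]; simp
    simp at this
  · have : (0 : ℕ) ∈ ({1, 2} : Set ℕ) := by rw [h]; simp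
    simp at this

theorem comp_inj {u u' : V} {c c' : (SimpleGraph.fromEdgeSet E).ConnectedComponent}
    (h : (SimpleGraph.fromEdgeSet E).connectedComponentMk u = c)
    (h' : (SimpleGraph.fromEdgeSet E).connectedComponentMk u' = c')
    (hr : ¬¬(SimpleGraph.fromEdgeSet E).Reachable u u') : c = c' := by
  rw [← h, ← h']
  exact SimpleGraph.ConnectedComponent.sound (not_not.mp hr)

theorem blueprint_acyclic (hP : ParSpec G v0 v1 v2 B0 par) (hB : IsSpanningTree G B)
    (hphi : IsPhi1 G v0 v1 v2 B0 B E m) : bpAcyclic B0 v0 v1 v2 E m := by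
  have sep := fun {u a b} => strong_sep (u := u) (a := a) (b := b) hP hB hphi
  have lnk := fun {u u' a b} => weak_link (u := u) (u' := u') (a := a) (b := b) hP hphi
  have two := fun {u a b} => strong_of_two (u := u) (a := a) (b := b) hP hB hphi
  have three := fun {u} => strong_of_three (u := u) hP hB hphi
  refine ⟨?_, ?_, ?_, ?_⟩
  · unfold bpMult
    rw [Set.ncard_le_one (Set.toFinite _)]
    rintro c ⟨u, _, hc, h⟩ c' ⟨u', _, hc', h'⟩
    refine comp_inj hc hc' fun hr => ?_
    have hs : ∀ w, (compMarks E m w = 2 ∧ (0 : ℕ) ≠ 1 ∧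
          1 ≤ markTypeCount B0 v0 v1 v2 E m w 0 ∧ 1 ≤ markTypeCount B0 v0 v1 v2 E m w 1) ∨
        (compMarks E m w = 3 ∧
          (({0, 1} : Set ℕ) = {0, 1} ∨ ({0, 1} : Set ℕ) = {0, 2})) →
        StrongLink B0 v0 v1 v2 E m w 0 1 := by
      rintro w (⟨k, k1, k2, k3⟩ | ⟨k, _⟩)
      · exact two k k1 k2 k3
      · exact (three k).1
    exact sep (hs u h) (lnk hr (hs u' h').weak)
  · unfold bpMult
    rw [Set.ncard_le_one (Set.toFinite _)]
    rintro c ⟨u, _, hc, h⟩ c' ⟨u', _, hc', h'⟩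
    refine comp_inj hc hc' fun hr => ?_
    rcases h with ⟨k, k1, k2, k3⟩ | ⟨k, _⟩ <;> rcases h' with ⟨l, l1, l2, l3⟩ | ⟨l, _⟩
    · exact sep (two k k1 k2 k3) (lnk hr (two l l1 l2 l3).weak)
    · exact sep (two k k1 k2 k3) (lnk hr (three l).2)
    · exact sep (two l l1 l2 l3) (lnk (fun h => hr h.symm) (three k).2)
    · exact sep (three k).1 (lnk hr (three l).1.weak)
  · unfold bpMult
    rw [Set.ncard_le_one (Set.toFinite _)]
    rintro c ⟨u, _, hc, h⟩ c' ⟨u', _, hc', h'⟩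
    refine comp_inj hc hc' fun hr => ?_
    rcases h with ⟨k, k1, k2, k3⟩ | ⟨_, k⟩
    · rcases h' with ⟨l, l1, l2, l3⟩ | ⟨_, l⟩
      · exact sep (two k k1 k2 k3) (lnk hr (two l l1 l2 l3).weak)
      · exact pair01 l
    · exact pair01 k
  · rintro ⟨h01, h02, h12⟩
    unfold bpMult at h01 h02 h12
    obtain ⟨c, u, _, _, h⟩ := Set.nonempty_of_ncard_ne_zero (Nat.one_le_iff_ne_zero.1 h01)
    clear h01
    obtain ⟨c', u', _, _, h'⟩ := Set.nonempty_of_ncard_ne_zero (Nat.one_le_iff_ne_zero.1 h02)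
    clear h02
    obtain ⟨c'', w, _, _, h''⟩ := Set.nonempty_of_ncard_ne_zero (Nat.one_le_iff_ne_zero.1 h12)
    clear h12
    rcases h'' with ⟨l, l1, l2, l3⟩ | ⟨_, l⟩
    swap
    · exact pair01 l
    have hsum := compMarks_eq hP hphi w
    have hcm : ∀ z, (SimpleGraph.fromEdgeSet E).Reachable w z →
        compMarks E m z = compMarks E m w := by
      intro z hz
      unfold compMarks
      refine Finset.sum_congr rfl fun x _ => ?_
      have : (SimpleGraph.fromEdgeSet E).Reachable z x ↔
        (SimpleGraph.fromEdgeSet E).Reachable w x := ⟨hz.trans, hz.symm.trans⟩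
      simp only [this]
    have hmt : ∀ z t, (SimpleGraph.fromEdgeSet E).Reachable w z →
        markTypeCount B0 v0 v1 v2 E m z t = markTypeCount B0 v0 v1 v2 E m w t := by
      intro z t hz
      unfold markTypeCount
      refine Finset.sum_congr rfl fun x _ => ?_
      have : (SimpleGraph.fromEdgeSet E).Reachable z x ↔
        (SimpleGraph.fromEdgeSet E).Reachable w x := ⟨hz.trans, hz.symm.trans⟩
      simp only [this]
    have hu : ¬(SimpleGraph.fromEdgeSet E).Reachable w u := by
      intro hr
      have e1 := hcm u hr
      have e2 := hmt u 0 hr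
      rcases h with ⟨k, k1, k2, k3⟩ | ⟨k, _⟩ <;> omega
    have hu' : ¬(SimpleGraph.fromEdgeSet E).Reachable w u' := by
      intro hr
      have e1 := hcm u' hr
      have e2 := hmt u' 0 hr
      rcases h' with ⟨k, k1, k2, k3⟩ | ⟨k, _⟩ <;> omega
    have w1 : WeakLink B0 v0 v1 v2 E m u 0 1 := by
      rcases h with ⟨k, k1, k2, k3⟩ | ⟨k, _⟩
      · exact (two k k1 k2 k3).weak
      · exact (three k).1.weak
    have w2 : WeakLink B0 v0 v1 v2 E m u' 0 2 := by
      rcases h' with ⟨k, k1, k2, k3⟩ | ⟨k, _⟩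
      · exact (two k k1 k2 k3).weak
      · exact (three k).2
    exact sep (two l l1 l2 l3) ((lnk hu w1).symm.trans (lnk hu' w2))

theorem trirooted (hP : ParSpec G v0 v1 v2 B0 par) (hB : IsSpanningTree G B)
    (hphi : IsPhi1 G v0 v1 v2 B0 B E m) : IsTriRootedForest G v0 v1 v2 B0 E m := by
  refine ⟨⟨?_, ?_, ?_, ?_⟩, ?_, blueprint_acyclic hP hB hphi⟩
  · rw [hphi.1]; exact Set.inter_subset_right
  · refine hB.2.isAcyclic.anti (SimpleGraph.fromEdgeSet_mono ?_)
    rw [hphi.1]; exact Set.inter_subset_left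
  · by_contra h
    rcases (marked_iff hP hphi v0).1 (Nat.one_le_iff_ne_zero.2 h) with h | h | h
    · exact hP.n01 h
    · exact hP.n02 h
    · exact h.1 rfl
  · intro v
    have h2 := hphi.2.1 v
    split_ifs with h
    · exact h2
    · by_contra hc
      exact h (doubly_type hP hphi (by omega))
  · intro u hu
    refine ⟨?_, ?_, ?_, markType_le hP hB hphi u, ?_⟩
    · obtain ⟨p⟩ := hB.2.connected.preconnected u v0
      obtain ⟨x, _, hx, hm⟩ := hit hP hB hphi p hu (Or.inl rfl)
      refine hm.trans ?_
      unfold compMarks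
      have := Finset.single_le_sum (s := Finset.univ)
        (f := fun x => if (SimpleGraph.fromEdgeSet E).Reachable u x then m x else 0)
        (fun _ _ => Nat.zero_le _) (Finset.mem_univ x)
      simpa [hx] using this
    · exact fun _ => (marked_iff hP hphi v1).2 (Or.inl rfl)
    · exact fun _ => (marked_iff hP hphi v2).2 (Or.inr (Or.inl rfl))
    · intro x hx hm
      obtain ⟨x', h1, h2, h3⟩ := doubly_other hP hB hphi hm
      exact ⟨x', hx.trans h1, h2, h3⟩

end Aux

section Statements

variable (G : SimpleGraph V) (v0 v1 v2 : V) (B0 : Set (Sym2 V))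

theorem statement6
    (hG : IsTriconed G v0 v1 v2)
    (hvo : VertexOrderSpec G v0 v1 v2)
    (heo : EdgeOrderSpec G v0 v1 v2)
    (hnc : NoColoops G)
    (hB0 : IsMinSpanningTree G B0)
    (B : Set (Sym2 V)) (hB : IsSpanningTree G B)
    (E : Set (Sym2 V)) (m : V → ℕ)
    (hphi : IsPhi1 G v0 v1 v2 B0 B E m) :
    IsTriRootedForest G v0 v1 v2 B0 E m := by
  exact trirooted (parSpec_of_min hG heo hB0) hB hphi

end Statements
end

section
/- Let G be a triconed graph with no coloops and let B be a spanning tree of G. Then every edge of B is internally passive if and only if the blueprint of φ1(B) is spanning (i.e., all three vertices 0, 1, 2 lie in one connected component of the blueprint) and no component of φ1(B) has a unique mark located at a normal vertex that is the smallest vertex of its component in the vertex order. -/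
open scoped Classical

variable {V : Type} [Fintype V] [LinearOrder V] [LinearOrder (Sym2 V)]

section Helpers
set_option linter.unusedSectionVars false
open SimpleGraph

/-- Reachability preserves a property that is closed under adjacency. -/
theorem hx_closed {W : Type} {H : SimpleGraph W} {P : W → Prop}
    (h : ∀ a b, H.Adj a b → P a → P b) {a b : W} (hr : H.Reachable a b) (ha : P a) : P b := by
  obtain ⟨p⟩ := hr
  induction p with
  | nil => exact ha
  | cons hadj _ ih => exact ih (h _ _ hadj ha)

theorem hx_mono {W : Type} {S T : Set (Sym2 W)} (h : S ⊆ T) {a b : W}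
    (hr : (fromEdgeSet S).Reachable a b) : (fromEdgeSet T).Reachable a b :=
  hr.mono (fromEdgeSet_mono h)

theorem hx_edge {W : Type} {S : Set (Sym2 W)} {a b : W} (h : s(a, b) ∈ S) :
    (fromEdgeSet S).Reachable a b := by
  by_cases hab : a = b
  · subst hab; exact Reachable.refl _
  · exact Adj.reachable (by simp [fromEdgeSet_adj, h, hab])

theorem hx_bridge {W : Type} {T : Set (Sym2 W)} (hT : (fromEdgeSet T).IsTree) {a b : W}
    (hab : a ≠ b) (h : s(a, b) ∈ T) : ¬(fromEdgeSet (T \ {s(a, b)})).Reachable a b := by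
  have h1 := isAcyclic_iff_forall_isBridge.1 hT.isAcyclic
    (e := s(a, b)) (by simp [h, hab])
  rw [isBridge_iff] at h1
  rw [fromEdgeSet_sdiff]
  exact h1

theorem hx_side {W : Type} {T : Set (Sym2 W)} (hT : (fromEdgeSet T).IsTree) {a b : W}
    (u : W) : (fromEdgeSet (T \ {s(a, b)})).Reachable a u ∨
      (fromEdgeSet (T \ {s(a, b)})).Reachable b u := by
  refine hx_closed (P := fun u => (fromEdgeSet (T \ {s(a, b)})).Reachable a u ∨
      (fromEdgeSet (T \ {s(a, b)})).Reachable b u) ?_ (hT.connected.preconnected a u)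
      (Or.inl (Reachable.refl _))
  intro c d hcd hc
  rw [fromEdgeSet_adj] at hcd
  by_cases hE : s(c, d) = s(a, b)
  · rw [Sym2.eq_iff] at hE
    rcases hE with ⟨rfl, rfl⟩ | ⟨rfl, rfl⟩
    · right; exact Reachable.refl _
    · left; exact Reachable.refl _
  · have : (fromEdgeSet (T \ {s(a, b)})).Reachable c d := hx_edge ⟨hcd.1, hE⟩
    exact hc.imp (fun h => h.trans this) (fun h => h.trans this)

theorem hx_exchange {T : Set (Sym2 V)} {G : SimpleGraph V}
    (hT : IsSpanningTree G T) {e f : Sym2 V} {c d : V} (he : e ∈ T) (hf : f ∈ G.edgeSet)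
    (hfe : f = s(c, d))
    (hcd : ¬(fromEdgeSet (T \ {e})).Reachable c d) :
    IsSpanningTree G (insert f (T \ {e})) := by
  subst hfe
  refine ⟨Set.insert_subset hf (Set.sdiff_subset.trans hT.1), ?_, ?_⟩
  · have hne : Nonempty V := ⟨c⟩
    induction e using Sym2.ind with
    | _ a b =>
    have key : ∀ u, (fromEdgeSet (insert s(c, d) (T \ {s(a, b)}))).Reachable c u := by
      have hm : ∀ {x y}, (fromEdgeSet (T \ {s(a, b)})).Reachable x y →
          (fromEdgeSet (insert s(c, d) (T \ {s(a, b)}))).Reachable x y :=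
        fun h => hx_mono (Set.subset_insert _ _) h
      have hcd' : (fromEdgeSet (insert s(c, d) (T \ {s(a, b)}))).Reachable c d :=
        hx_edge (Set.mem_insert _ _)
      intro u
      rcases hx_side hT.2 (a := a) (b := b) u with hu | hu <;>
      rcases hx_side hT.2 (a := a) (b := b) c with hc | hc <;>
      rcases hx_side hT.2 (a := a) (b := b) d with hd | hd
      · exact absurd (hc.symm.trans hd) hcd
      · exact (hm hc).symm.trans (hm hu)
      · exact hcd'.trans ((hm hd).symm.trans (hm hu))
      · exact absurd (hc.symm.trans hd) hcd
      · exact absurd (hc.symm.trans hd) hcd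
      · exact hcd'.trans ((hm hd).symm.trans (hm hu))
      · exact (hm hc).symm.trans (hm hu)
      · exact absurd (hc.symm.trans hd) hcd
    exact ⟨fun x y => (key x).symm.trans (key y)⟩
  · have h1 : (fromEdgeSet (T \ {e})).IsAcyclic :=
      hT.2.isAcyclic.anti (fromEdgeSet_mono Set.sdiff_subset)
    have h2 := h1.sup_edge_of_not_reachable hcd
    refine h2.anti ?_
    intro x y hxy
    simp only [fromEdgeSet_adj, Set.mem_insert_iff, sup_adj, edge_adj, Sym2.eq_iff] at hxy ⊢
    tauto

theorem hx_cross {T : Set (Sym2 V)} {G : SimpleGraph V} {e : Sym2 V} {c d : V}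
    (hcd : c ≠ d) (hf : s(c, d) ∉ T)
    (hT' : IsSpanningTree G (insert s(c, d) (T \ {e}))) :
    ¬(fromEdgeSet (T \ {e})).Reachable c d := by
  intro h
  refine hx_bridge hT'.2 hcd (Set.mem_insert _ _) (hx_mono ?_ h)
  intro x hx
  exact ⟨Set.mem_insert_of_mem _ hx, fun h' => hf (by rw [Set.mem_singleton_iff] at h'; exact h' ▸ hx.1)⟩

/-- A crossing smaller edge makes `e` passive. -/
theorem hx_passive {T : Set (Sym2 V)} {G : SimpleGraph V}
    (hT : IsSpanningTree G T) {e : Sym2 V} {c d : V} (he : e ∈ T) (hf : s(c, d) ∈ G.edgeSet)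
    (hlt : s(c, d) < e) (hcd : ¬(fromEdgeSet (T \ {e})).Reachable c d) :
    InternallyPassive G T e :=
  ⟨he, s(c, d), hf, fun h => hcd (hx_edge ⟨h, fun h' => hlt.ne h'⟩), hlt,
    hx_exchange hT he hf rfl hcd⟩

/-- Splitting a path at its first edge outside `A`. -/
theorem hx_split {W : Type} {B A : Set (Sym2 W)} {g : Sym2 W} {u w : W}
    (p : (fromEdgeSet B).Walk u w) : p.IsPath → g ∉ p.edges → ∀ i : ℕ,
    (∀ j < i, ∀ e, p.edges[j]? = some e → e ∈ A) →
    (∃ e, p.edges[i]? = some e ∧ e ∉ A) →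
    (fromEdgeSet (A \ {g})).Reachable u (p.getVert i) ∧
    ∃ x', s(p.getVert i, x') ∈ B ∧ s(p.getVert i, x') ∉ A ∧ x' ≠ p.getVert i ∧
      ∃ q : (fromEdgeSet B).Walk x' w, p.getVert i ∉ q.support := by
  induction p with
  | nil => intro _ _ i _ h; simp at h
  | @cons a b c hadj p ih =>
    intro hp hg i h1 h2
    rw [Walk.cons_isPath_iff] at hp
    rw [Walk.edges_cons, List.mem_cons, not_or] at hg
    cases i with
    | zero =>
      simp only [Walk.edges_cons, List.getElem?_cons_zero, Option.some.injEq] at h2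
      obtain ⟨e, rfl, he⟩ := h2
      rw [fromEdgeSet_adj] at hadj
      rw [Walk.getVert_zero]
      exact ⟨Reachable.refl _, b, hadj.1, he, hadj.2.symm, p, hp.2⟩
    | succ i =>
      rw [Walk.getVert_cons_succ]
      have h3 := ih hp.1 hg.2 i (fun j hj e he => h1 (j + 1) (by omega) e (by simpa using he))
        (by simpa using h2)
      refine ⟨Reachable.trans ?_ h3.1, h3.2⟩
      refine hx_edge ⟨h1 0 (by omega) _ (by simp), ?_⟩
      exact fun h => hg.1 h.symm

/-- Existence of a first edge outside `A`. -/
theorem hx_first {W : Type} {A : Set (Sym2 W)} (l : List (Sym2 W)) (h : ∃ e ∈ l, e ∉ A) :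
    ∃ i : ℕ, (∀ j < i, ∀ e, l[j]? = some e → e ∈ A) ∧ ∃ e, l[i]? = some e ∧ e ∉ A := by
  have hex : ∃ i : ℕ, ∃ e, l[i]? = some e ∧ e ∉ A := by
    obtain ⟨e, he, hA⟩ := h
    obtain ⟨i, hi⟩ := List.mem_iff_getElem?.1 he
    exact ⟨i, e, hi, hA⟩
  refine ⟨Nat.find hex, fun j hj e he => ?_, Nat.find_spec hex⟩
  by_contra hA
  exact Nat.find_min hex hj ⟨e, he, hA⟩

/-- The parent of a vertex in the minimum spanning tree. -/
noncomputable def hxPar (G : SimpleGraph V) (v0 v1 v2 : V) (u : V) : V :=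
  if G.Adj v0 u then v0 else if G.Adj v1 u then v1 else v2

variable {G : SimpleGraph V} {v0 v1 v2 : V} {B0 B : Set (Sym2 V)}

theorem hx_par_root (u : V) : hxPar G v0 v1 v2 u = v0 ∨ hxPar G v0 v1 v2 u = v1 ∨
    hxPar G v0 v1 v2 u = v2 := by
  unfold hxPar; split_ifs <;> simp

theorem hx_par1 (hG : IsTriconed G v0 v1 v2) : hxPar G v0 v1 v2 v1 = v0 := by
  simp [hxPar, hG.2.2.2.2.1]

theorem hx_par2 (hG : IsTriconed G v0 v1 v2) : hxPar G v0 v1 v2 v2 = v0 := by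
  simp [hxPar, hG.2.2.2.2.2.1]

theorem hx_par_adj (hG : IsTriconed G v0 v1 v2) {u : V} (hu : u ≠ v0) :
    G.Adj u (hxPar G v0 v1 v2 u) := by
  obtain ⟨_, h01, h02, h12, a1, a2, hall⟩ := hG
  by_cases h1 : u = v1
  · subst h1; simp only [hxPar, a1, if_true]; exact a1.symm
  by_cases h2 : u = v2
  · subst h2; simp only [hxPar, a2, if_true]; exact a2.symm
  have := hall u hu h1 h2
  unfold hxPar
  split_ifs with h h'
  · exact h.symm
  · exact h'.symm
  · exact (by tauto : G.Adj v2 u).symm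

/-- The explicit minimum spanning tree. -/
def hxS (G : SimpleGraph V) (v0 v1 v2 : V) : Set (Sym2 V) :=
  {e | ∃ u, u ≠ v0 ∧ e = s(u, hxPar G v0 v1 v2 u)}

theorem hx_S_block (hG : IsTriconed G v0 v1 v2) {e : Sym2 V} (he : e ∈ G.edgeSet) :
    e ∈ hxS G v0 v1 v2 ↔ edgeBlock G v0 v1 v2 e ≤ 2 := by
  obtain ⟨hc, h01, h02, h12, a1, a2, hall⟩ := hG
  constructor
  · rintro ⟨u, hu, rfl⟩
    unfold edgeBlock
    by_cases h0 : G.Adj v0 u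
    · simp [hxPar, h0]
    · by_cases h1 : G.Adj v1 u
      · have : ∃ x, s(u, v1) = s(v1, x) ∧ ¬G.Adj v0 x := ⟨u, Sym2.eq_swap, h0⟩
        simp only [hxPar, h0, h1, if_false, if_true]
        rw [if_pos this]
        split_ifs <;> omega
      · have : ∃ x, s(u, v2) = s(v2, x) ∧ ¬G.Adj v0 x ∧ ¬ G.Adj v1 x :=
          ⟨u, Sym2.eq_swap, h0, h1⟩
        simp only [hxPar, h0, h1, if_false]
        rw [if_pos this]
        split_ifs <;> omega
  · intro h
    unfold edgeBlock at h
    split_ifs at h with k0 k1 k2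
    · obtain ⟨x, rfl⟩ := Sym2.mem_iff_exists.1 k0
      have hx : G.Adj v0 x := he
      exact ⟨x, hx.ne', by simp [hxPar, hx, Sym2.eq_swap]⟩
    · obtain ⟨x, rfl, hx⟩ := k1
      have hx1 : G.Adj v1 x := he
      exact ⟨x, fun h => k0 (by simp [h]), by simp [hxPar, hx, hx1, Sym2.eq_swap]⟩
    · obtain ⟨x, rfl, hx, hx1⟩ := k2
      exact ⟨x, fun h => k0 (by simp [h]), by simp [hxPar, hx, hx1, Sym2.eq_swap]⟩
    · omega

theorem hx_S_reach (hG : IsTriconed G v0 v1 v2) (u : V) :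
    (fromEdgeSet (hxS G v0 v1 v2)).Reachable u v0 := by
  have h1 : (fromEdgeSet (hxS G v0 v1 v2)).Reachable v1 v0 :=
    hx_edge ⟨v1, hG.2.1.symm, by rw [hx_par1 hG]⟩
  have h2 : (fromEdgeSet (hxS G v0 v1 v2)).Reachable v2 v0 :=
    hx_edge ⟨v2, hG.2.2.1.symm, by rw [hx_par2 hG]⟩
  by_cases hu : u = v0
  · subst hu; exact Reachable.refl _
  have h3 : (fromEdgeSet (hxS G v0 v1 v2)).Reachable u (hxPar G v0 v1 v2 u) :=
    hx_edge ⟨u, hu, rfl⟩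
  rcases hx_par_root (G := G) (v0 := v0) (v1 := v1) (v2 := v2) u with h | h | h <;> rw [h] at h3
  · exact h3
  · exact h3.trans h1
  · exact h3.trans h2

theorem hx_S_tree (hG : IsTriconed G v0 v1 v2) : IsSpanningTree G (hxS G v0 v1 v2) := by
  refine ⟨?_, ?_⟩
  · rintro e ⟨u, hu, rfl⟩
    exact hx_par_adj hG hu
  · have hne : Nonempty V := ⟨v0⟩
    have hconn : (fromEdgeSet (hxS G v0 v1 v2)).Connected :=
      ⟨fun x y => (hx_S_reach hG x).trans (hx_S_reach hG y).symm⟩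
    rw [isTree_iff_connected_and_card]
    refine ⟨hconn, le_antisymm ?_ hconn.card_vert_le_card_edgeSet_add_one⟩
    have hsub : (fromEdgeSet (hxS G v0 v1 v2)).edgeSet ⊆
        (fun u => s(u, hxPar G v0 v1 v2 u)) '' ({v0}ᶜ : Set V) := by
      intro e he
      rw [edgeSet_fromEdgeSet] at he
      obtain ⟨u, hu, rfl⟩ := he.1
      exact ⟨u, hu, rfl⟩
    have h1 : Nat.card (fromEdgeSet (hxS G v0 v1 v2)).edgeSet ≤ ({v0}ᶜ : Set V).ncard := by
      rw [Nat.card_coe_set_eq]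
      exact (Set.ncard_le_ncard hsub (Set.toFinite _)).trans (Set.ncard_image_le (Set.toFinite _))
    have h2 := Set.ncard_add_ncard_compl ({v0} : Set V)
    rw [Set.ncard_singleton] at h2
    omega

theorem hx_B0_eq (hG : IsTriconed G v0 v1 v2) (heo : EdgeOrderSpec G v0 v1 v2)
    (hB0 : IsMinSpanningTree G B0) : B0 = hxS G v0 v1 v2 := by
  by_contra hne
  have hS := hx_S_tree hG
  obtain ⟨e, he, heS, hmin⟩ := hB0.2 _ hS (Ne.symm hne)
  have hex : ∃ f, f ∈ hxS G v0 v1 v2 ∧ f ∉ B0 := by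
    by_contra! hsub
    induction e using Sym2.ind with
    | _ a b =>
    have hab : G.Adj a b := hB0.1.1 he
    refine hx_bridge hB0.1.2 hab.ne he (hx_mono ?_ (hS.2.connected.preconnected a b))
    intro f hf
    exact ⟨hsub f hf, fun h => heS (by rw [Set.mem_singleton_iff] at h; exact h ▸ hf)⟩
  obtain ⟨f, hf, hfB⟩ := hex
  have h1 : e < f := hmin f (Or.inr ⟨hf, hfB⟩) (fun h => heS (h ▸ hf))
  have h2 : f < e := by
    apply heo.1 f (hS.1 hf) e (hB0.1.1 he)
    have := (hx_S_block hG (hS.1 hf)).1 hf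
    have := mt (hx_S_block hG (hB0.1.1 he)).2 heS
    omega
  exact lt_asymm h1 h2


/-- The standing assumptions. -/
structure HxCtx (G : SimpleGraph V) (v0 v1 v2 : V) (B0 B E : Set (Sym2 V)) (m : V → ℕ) :
    Prop where
  hG : IsTriconed G v0 v1 v2
  hvo : VertexOrderSpec G v0 v1 v2
  heo : EdgeOrderSpec G v0 v1 v2
  hB0 : B0 = hxS G v0 v1 v2
  hB : IsSpanningTree G B
  hphi : IsPhi1 G v0 v1 v2 B0 B E m

/-- The root vertex of a type. -/
def hxRt (v0 v1 v2 : V) (t : ℕ) : V := if t = 1 then v1 else if t = 2 then v2 else v0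

variable {E : Set (Sym2 V)} {m : V → ℕ}

theorem hx_B0_tree (c : HxCtx G v0 v1 v2 B0 B E m) : IsSpanningTree G B0 := by
  rw [c.hB0]; exact hx_S_tree c.hG

theorem hx_B0_mem (c : HxCtx G v0 v1 v2 B0 B E m) {u : V} (hu : u ≠ v0) :
    s(u, hxPar G v0 v1 v2 u) ∈ B0 := by
  rw [c.hB0]; exact ⟨u, hu, rfl⟩

theorem hx_e01 (c : HxCtx G v0 v1 v2 B0 B E m) : s(v0, v1) ∈ B0 := by
  have := hx_B0_mem c c.hG.2.1.symm
  rwa [hx_par1 c.hG, Sym2.eq_swap] at this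

theorem hx_e02 (c : HxCtx G v0 v1 v2 B0 B E m) : s(v0, v2) ∈ B0 := by
  have := hx_B0_mem c c.hG.2.2.1.symm
  rwa [hx_par2 c.hG, Sym2.eq_swap] at this

/-- In `B0` minus the edge above `u`, roots distinct from `u` still reach `v0`. -/
theorem hx_root_reach (c : HxCtx G v0 v1 v2 B0 B E m) {r q : V}
    (hr : r = v0 ∨ r = v1 ∨ r = v2) (hq : q ≠ v0) :
    (fromEdgeSet (B0 \ {s(q, r)})).Reachable r v0 := by
  rcases hr with rfl | rfl | rfl
  · exact Reachable.refl _
  · refine Reachable.symm (hx_edge ⟨hx_e01 c, ?_⟩)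
    rw [Set.mem_singleton_iff, Sym2.eq_iff]
    have := c.hG.2.1
    rintro (⟨h, _⟩ | ⟨h, _⟩)
    · exact hq h.symm
    · exact this h
  · refine Reachable.symm (hx_edge ⟨hx_e02 c, ?_⟩)
    rw [Set.mem_singleton_iff, Sym2.eq_iff]
    have := c.hG.2.2.1
    rintro (⟨h, _⟩ | ⟨h, _⟩)
    · exact hq h.symm
    · exact this h

theorem hx_child (c : HxCtx G v0 v1 v2 B0 B E m) (u q : V) :
    IsChildOf B0 v0 u q ↔ u ≠ v0 ∧ q = hxPar G v0 v1 v2 u := by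
  constructor
  · rintro ⟨hmem, hnr⟩
    have hu : u ≠ v0 := fun h => hnr (h ▸ Reachable.refl _)
    refine ⟨hu, ?_⟩
    have hmem' := hmem
    rw [c.hB0] at hmem'
    obtain ⟨w, hw, hww⟩ := hmem'
    rw [Sym2.eq_iff] at hww
    rcases hww with ⟨rfl, rfl⟩ | ⟨h1, rfl⟩
    · rfl
    · exfalso
      apply hnr
      have := hx_root_reach c (r := u) (q := q) (h1 ▸ hx_par_root q) hw
      rwa [Sym2.eq_swap] at this
  · rintro ⟨hu, rfl⟩
    refine ⟨hx_B0_mem c hu, fun h => ?_⟩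
    refine hx_bridge (hx_B0_tree c).2 (hx_par_adj c.hG hu).ne (hx_B0_mem c hu) ?_
    exact h.trans (hx_root_reach c (hx_par_root u) hu).symm

theorem hx_marked (c : HxCtx G v0 v1 v2 B0 B E m) (v : V) :
    1 ≤ m v ↔ (v = v1 ∨ v = v2 ∨ (v ≠ v0 ∧ s(v, hxPar G v0 v1 v2 v) ∈ B)) := by
  rw [c.hphi.2.2.1 v]
  simp only [hx_child c]
  constructor
  · rintro (h | h | ⟨p, ⟨h1, rfl⟩, h2⟩)
    · exact Or.inl h
    · exact Or.inr (Or.inl h)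
    · exact Or.inr (Or.inr ⟨h1, h2⟩)
  · rintro (h | h | ⟨h1, h2⟩)
    · exact Or.inl h
    · exact Or.inr (Or.inl h)
    · exact Or.inr (Or.inr ⟨_, ⟨h1, rfl⟩, h2⟩)

theorem hx_marked_ne (c : HxCtx G v0 v1 v2 B0 B E m) {v : V} (h : 1 ≤ m v) : v ≠ v0 := by
  rcases (hx_marked c v).1 h with h | h | h
  · rw [h]; exact c.hG.2.1.symm
  · rw [h]; exact c.hG.2.2.1.symm
  · exact h.1

theorem hx_ty_le (v : V) : vType B0 v0 v1 v2 v ≤ 2 := by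
  unfold vType; split_ifs <;> omega

theorem hx_ty1 : vType B0 v0 v1 v2 v1 = 1 := by simp [vType]

theorem hx_ty2 (c : HxCtx G v0 v1 v2 B0 B E m) : vType B0 v0 v1 v2 v2 = 2 := by
  have h := c.hG.2.2.2.1
  have h' := c.hG.2.1
  simp [vType, hx_child c, hx_par2 c.hG, h.symm, h'.symm]

theorem hx_rt_ty (c : HxCtx G v0 v1 v2 B0 B E m) {v : V} (h0 : v ≠ v0) (h1 : v ≠ v1)
    (h2 : v ≠ v2) : hxRt v0 v1 v2 (vType B0 v0 v1 v2 v) = hxPar G v0 v1 v2 v := by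
  have k01 := c.hG.2.1
  have k02 := c.hG.2.2.1
  have k12 := c.hG.2.2.2.1
  unfold vType
  simp only [hx_child c, h0, h1, h2, false_or, ne_eq, not_false_eq_true, true_and]
  rcases hx_par_root (G := G) (v0 := v0) (v1 := v1) (v2 := v2) v with h | h | h <;> rw [h] <;>
    simp [hxRt, k01.symm, k02.symm, k12]

theorem hx_rt_root (t : ℕ) : hxRt v0 v1 v2 t = v0 ∨ hxRt v0 v1 v2 t = v1 ∨
    hxRt v0 v1 v2 t = v2 := by
  unfold hxRt; split_ifs <;> simp

/-- The edge above a vertex determines it. -/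
theorem hx_up_inj (c : HxCtx G v0 v1 v2 B0 B E m) {x y : V} (hx : x ≠ v0) (hy : y ≠ v0)
    (h : s(x, hxPar G v0 v1 v2 x) = s(y, hxPar G v0 v1 v2 y)) : x = y := by
  rw [Sym2.eq_iff] at h
  rcases h with ⟨h, _⟩ | ⟨h1, h2⟩
  · exact h
  · exfalso
    have e1 := hx_par1 c.hG
    have e2 := hx_par2 c.hG
    rcases hx_par_root (G := G) (v0 := v0) (v1 := v1) (v2 := v2) x with h | h | h
    · exact hy (h2.symm.trans h)
    · have hy1 := h2.symm.trans h
      rw [hy1, e1] at h1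
      exact hx h1
    · have hy1 := h2.symm.trans h
      rw [hy1, e2] at h1
      exact hx h1

theorem hx_attach (c : HxCtx G v0 v1 v2 B0 B E m) {x : V} {e : Sym2 V} (hx : 1 ≤ m x)
    (h : x ≠ v1 → x ≠ v2 → e ≠ s(x, hxPar G v0 v1 v2 x)) :
    (fromEdgeSet (B \ {e})).Reachable x (hxRt v0 v1 v2 (vType B0 v0 v1 v2 x)) := by
  by_cases h1 : x = v1
  · subst h1; rw [hx_ty1]; simp only [hxRt, if_true]; exact Reachable.refl _
  by_cases h2 : x = v2
  · subst h2; rw [hx_ty2 c]; simp only [hxRt]; exact Reachable.refl _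
  have h0 := hx_marked_ne c hx
  rw [hx_rt_ty c h0 h1 h2]
  have := (hx_marked c x).1 hx
  simp only [h1, h2, h0, false_or, ne_eq, not_false_eq_true, true_and] at this
  exact hx_edge ⟨this, fun h' => h h1 h2 h'.symm⟩

theorem hx_E_sub (c : HxCtx G v0 v1 v2 B0 B E m) {e : Sym2 V} (he : e ∈ B0) :
    E ⊆ B \ {e} := by
  rw [c.hphi.1]
  rintro f ⟨h1, h2⟩
  exact ⟨h1, fun h => h2.2.1 (by rw [Set.mem_singleton_iff] at h; exact h ▸ he)⟩

theorem hx_E_reach (c : HxCtx G v0 v1 v2 B0 B E m) {e : Sym2 V} (he : e ∈ B0) {x y : V}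
    (h : (fromEdgeSet E).Reachable x y) : (fromEdgeSet (B \ {e})).Reachable x y :=
  hx_mono (hx_E_sub c he) h

theorem hx_B_cases (c : HxCtx G v0 v1 v2 B0 B E m) {e : Sym2 V} (he : e ∈ B) :
    e ∈ E ∨ e ∈ B0 := by
  by_cases h : e ∈ B0
  · exact Or.inr h
  · left
    rw [c.hphi.1]
    refine ⟨he, c.hB.1 he, h, fun h0 => h ?_⟩
    rw [c.hB0, hx_S_block c.hG (c.hB.1 he)]
    simp [edgeBlock, h0]

theorem hx_E_ne (c : HxCtx G v0 v1 v2 B0 B E m) {x y : V}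
    (h : (fromEdgeSet E).Reachable x y) (hx : x ≠ v0) : y ≠ v0 := by
  refine hx_closed (P := fun y => y ≠ v0) ?_ h hx
  intro a b hab _ hb
  rw [fromEdgeSet_adj, c.hphi.1] at hab
  exact hab.1.2.2.2 (by simp [hb])

/-- A `B0`-edge of `B` leaving `z` shows that `z` is marked. -/
theorem hx_leave (c : HxCtx G v0 v1 v2 B0 B E m) {z w : V} (hz : z ≠ v0)
    (h : s(z, w) ∈ B) (h0 : s(z, w) ∈ B0) :
    1 ≤ m z ∧ (z = v1 ∨ z = v2 ∨ w = hxPar G v0 v1 v2 z) := by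
  rw [c.hB0] at h0
  obtain ⟨u, hu, he⟩ := h0
  rw [Sym2.eq_iff] at he
  rcases he with ⟨rfl, rfl⟩ | ⟨h1, rfl⟩
  · exact ⟨(hx_marked c z).2 (Or.inr (Or.inr ⟨hz, h⟩)), Or.inr (Or.inr rfl)⟩
  · have hr := hx_par_root (G := G) (v0 := v0) (v1 := v1) (v2 := v2) w
    rw [← h1] at hr
    have hr' : z = v1 ∨ z = v2 := by tauto
    refine ⟨(hx_marked c z).2 (by tauto), by tauto⟩

theorem hx_up_mem (c : HxCtx G v0 v1 v2 B0 B E m) {x : V} (hx : 1 ≤ m x) (h1 : x ≠ v1)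
    (h2 : x ≠ v2) : s(x, hxPar G v0 v1 v2 x) ∈ B := by
  have := (hx_marked c x).1 hx
  tauto

/-- Two marks in the same component have different types. -/
theorem hx_ty_inj (c : HxCtx G v0 v1 v2 B0 B E m) {x y : V} (hx : 1 ≤ m x) (hy : 1 ≤ m y)
    (hr : (fromEdgeSet E).Reachable x y)
    (ht : vType B0 v0 v1 v2 x = vType B0 v0 v1 v2 y) : x = y := by
  by_contra hne
  have hx0 := hx_marked_ne c hx
  have hy0 := hx_marked_ne c hy
  have key : ∀ {x y : V}, 1 ≤ m x → 1 ≤ m y → (fromEdgeSet E).Reachable x y →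
      vType B0 v0 v1 v2 x = vType B0 v0 v1 v2 y → x ≠ y → x ≠ v1 → x ≠ v2 → False := by
    intro x y hx hy hr ht hne h1 h2
    have hx0 := hx_marked_ne c hx
    have hy0 := hx_marked_ne c hy
    have hup := hx_up_mem c hx h1 h2
    refine hx_bridge c.hB.2 (hx_par_adj c.hG hx0).ne hup ?_
    have e1 := hx_E_reach c (hx_B0_mem c hx0) hr
    have e2 := hx_attach c (e := s(x, hxPar G v0 v1 v2 x)) hy
      (fun _ _ h => hne (hx_up_inj c hx0 hy0 h))
    rw [← ht, hx_rt_ty c hx0 h1 h2] at e2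
    exact e1.trans e2
  by_cases hn : x ≠ v1 ∧ x ≠ v2
  · exact key hx hy hr ht hne hn.1 hn.2
  by_cases hn' : y ≠ v1 ∧ y ≠ v2
  · exact key hy hx hr.symm ht.symm (Ne.symm hne) hn'.1 hn'.2
  have t1 : vType B0 v0 v1 v2 v1 = 1 := hx_ty1
  have t2 := hx_ty2 c
  have hx' : x = v1 ∨ x = v2 := by tauto
  have hy' : y = v1 ∨ y = v2 := by tauto
  rcases hx' with rfl | rfl <;> rcases hy' with rfl | rfl
  · exact hne rfl
  · omega
  · omega
  · exact hne rfl

/-- Order lemma for the edges of the minimum spanning tree. -/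
theorem hx_up_lt (c : HxCtx G v0 v1 v2 B0 B E m) {x y : V} (hx0 : x ≠ v0) (hx1 : x ≠ v1)
    (hx2 : x ≠ v2) (hy0 : y ≠ v0) (hy1 : y ≠ v1) (hy2 : y ≠ v2) (hxy : x < y) :
    s(x, hxPar G v0 v1 v2 x) < s(y, hxPar G v0 v1 v2 y) := by
  obtain ⟨o1, o2, o3, o4, o5⟩ := c.hvo
  have hx3 := o3 x hx0 hx1 hx2
  have hy3 := o3 y hy0 hy1 hy2
  have k01 := c.hG.2.1
  have k02 := c.hG.2.2.1
  have k12 := c.hG.2.2.2.1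
  have hgx : s(x, hxPar G v0 v1 v2 x) ∈ G.edgeSet := hx_par_adj c.hG hx0
  have hgy : s(y, hxPar G v0 v1 v2 y) ∈ G.edgeSet := hx_par_adj c.hG hy0
  have blk : ∀ z, z ≠ v0 → z ≠ v1 → z ≠ v2 →
      edgeBlock G v0 v1 v2 s(z, hxPar G v0 v1 v2 z) =
        if G.Adj v0 z then 0 else if G.Adj v1 z then 1 else 2 := by
    intro z h0 h1 h2
    unfold hxPar edgeBlock
    by_cases a0 : G.Adj v0 z
    · simp [a0]
    by_cases a1 : G.Adj v1 z
    · simp only [a0, a1, if_true, if_false]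
      rw [if_neg (by simp [h0.symm, k01]), if_pos ⟨z, Sym2.eq_swap, a0⟩]
    · simp only [a0, a1, if_false]
      rw [if_neg (by simp [h0.symm, k02]), if_neg, if_pos ⟨z, Sym2.eq_swap, a0, a1⟩]
      rintro ⟨w, hw, _⟩
      have : v1 ∈ s(z, v2) := by rw [hw]; simp
      simp [h1.symm, k12] at this
  have bx := blk x hx0 hx1 hx2
  have bY := blk y hy0 hy1 hy2
  have m1 : ∀ z r : V, r < z → sym2Min s(z, r) = r := fun z r h => by
    simp [sym2Min, h.le]
  have m2 : ∀ z r : V, r < z → sym2Max s(z, r) = z := fun z r h => by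
    simp [sym2Max, h.le]
  have hlex : hxPar G v0 v1 v2 x = hxPar G v0 v1 v2 y →
      Sym2Lex s(x, hxPar G v0 v1 v2 x) s(y, hxPar G v0 v1 v2 y) := by
    intro h
    have hz : ∀ z, v2 < z → hxPar G v0 v1 v2 z < z := by
      intro z hz
      rcases hx_par_root (G := G) (v0 := v0) (v1 := v1) (v2 := v2) z with h | h | h <;> rw [h]
      · exact o1.trans (o2.trans hz)
      · exact o2.trans hz
      · exact hz
    right
    rw [m1 _ _ (hz x hx3), m1 _ _ (hz y hy3), m2 _ _ (hz x hx3), m2 _ _ (hz y hy3)]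
    exact ⟨h, hxy⟩
  by_cases ax0 : G.Adj v0 x
  · by_cases ay0 : G.Adj v0 y
    · refine c.heo.2 _ hgx _ hgy ?_ ?_ (hlex ?_)
      · rw [bx, bY]; simp [ax0, ay0]
      · rw [bx]; simp [ax0]
      · simp [hxPar, ax0, ay0]
    · refine c.heo.1 _ hgx _ hgy ?_
      rw [bx, bY]; simp only [ax0, ay0, if_true, if_false]; split_ifs <;> omega
  · by_cases ay0 : G.Adj v0 y
    · exact absurd (o4 y x hy0 hy1 hy2 hx0 hx1 hx2 ay0 ax0) (not_lt.2 hxy.le)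
    by_cases ax1 : G.Adj v1 x
    · by_cases ay1 : G.Adj v1 y
      · refine c.heo.2 _ hgx _ hgy ?_ ?_ (hlex ?_)
        · rw [bx, bY]; simp [ax0, ay0, ax1, ay1]
        · rw [bx]; simp [ax0, ax1]
        · simp [hxPar, ax0, ay0, ax1, ay1]
      · refine c.heo.1 _ hgx _ hgy ?_
        rw [bx, bY]; simp [ax0, ay0, ax1, ay1]
    · by_cases ay1 : G.Adj v1 y
      · exact absurd (o5 y x hy0 hy1 hy2 hx0 hx1 hx2 ay0 ax0 ay1 ax1) (not_lt.2 hxy.le)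
      · refine c.heo.2 _ hgx _ hgy ?_ ?_ (hlex ?_)
        · rw [bx, bY]; simp [ax0, ay0, ax1, ay1]
        · rw [bx]; simp [ax0, ax1]
        · simp [hxPar, ax0, ay0, ax1, ay1]

/-- Block-zero edges are compared by their other endpoint. -/
theorem hx_zero_lt (c : HxCtx G v0 v1 v2 B0 B E m) {x y : V} (hx : G.Adj v0 x)
    (hy : G.Adj v0 y) (hxy : x < y) : s(v0, x) < s(v0, y) := by
  have h0 : ∀ z, z ≠ v0 → v0 < z := by
    intro z hz
    obtain ⟨o1, o2, o3, _⟩ := c.hvo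
    by_cases h1 : z = v1
    · rw [h1]; exact o1
    by_cases h2 : z = v2
    · rw [h2]; exact o1.trans o2
    exact o1.trans (o2.trans (o3 z hz h1 h2))
  refine c.heo.2 _ hx _ hy (by simp [edgeBlock]) (by simp [edgeBlock]) (Or.inr ?_)
  have lx := (h0 x hx.ne').le
  have ly := (h0 y hy.ne').le
  simp [sym2Min, sym2Max, lx, ly, hxy]

/-- `01` and `02` are smaller than the edge above a normal vertex. -/
theorem hx_root_lt (c : HxCtx G v0 v1 v2 B0 B E m) {x : V} (hx0 : x ≠ v0) (hx1 : x ≠ v1)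
    (hx2 : x ≠ v2) : s(v0, v1) < s(x, hxPar G v0 v1 v2 x) ∧
      s(v0, v2) < s(x, hxPar G v0 v1 v2 x) := by
  have a1 := c.hG.2.2.2.2.1
  have a2 := c.hG.2.2.2.2.2.1
  have k01 := c.hG.2.1
  have k02 := c.hG.2.2.1
  have o2 := c.hvo.2.1
  have o3 := c.hvo.2.2.1 x hx0 hx1 hx2
  by_cases ax : G.Adj v0 x
  · have : s(x, hxPar G v0 v1 v2 x) = s(v0, x) := by simp [hxPar, ax, Sym2.eq_swap]
    rw [this]
    exact ⟨hx_zero_lt c a1 ax (o2.trans o3), hx_zero_lt c a2 ax o3⟩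
  · have hg : s(x, hxPar G v0 v1 v2 x) ∈ G.edgeSet := hx_par_adj c.hG hx0
    have hpos : 0 < edgeBlock G v0 v1 v2 s(x, hxPar G v0 v1 v2 x) := by
      have : v0 ∉ s(x, hxPar G v0 v1 v2 x) := by
        simp only [hxPar, ax, if_false]
        split_ifs <;> simp [hx0.symm, k01, k02]
      unfold edgeBlock
      rw [if_neg this]
      split_ifs <;> omega
    exact ⟨c.heo.1 _ a1 _ hg (by simpa [edgeBlock] using hpos),
      c.heo.1 _ a2 _ hg (by simpa [edgeBlock] using hpos)⟩


theorem hx_walk_mark (c : HxCtx G v0 v1 v2 B0 B E m) {v w t : V}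
    (q : (fromEdgeSet B).Walk w t) : t = v1 → v ≠ v0 → v ∉ q.support →
    (fromEdgeSet E).Reachable v w →
    ∃ z, z ≠ v ∧ (fromEdgeSet E).Reachable v z ∧ 1 ≤ m z := by
  induction q with
  | nil =>
    intro ht _ hs hr
    rw [Walk.support_nil, List.mem_singleton] at hs
    exact ⟨_, Ne.symm hs, hr, (hx_marked c _).2 (Or.inl ht)⟩
  | @cons a b d hadj q ih =>
    intro ht hv hs hr
    rw [Walk.support_cons, List.mem_cons, not_or] at hs
    rw [fromEdgeSet_adj] at hadj
    rcases hx_B_cases c hadj.1 with hE | h0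
    · exact ih ht hv hs.2 (hr.trans (hx_edge hE))
    · exact ⟨a, Ne.symm hs.1, hr, (hx_leave c (hx_E_ne c hr hv) hadj.1 h0).1⟩

theorem hx_rt_eq2 (c : HxCtx G v0 v1 v2 B0 B E m) {t : ℕ} (h : hxRt v0 v1 v2 t = v2) :
    t = 2 := by
  have k02 := c.hG.2.2.1
  have k12 := c.hG.2.2.2.1
  unfold hxRt at h
  split_ifs at h with h1 h2
  · exact absurd h k12
  · exact h2
  · exact absurd h k02

theorem hx_dm (c : HxCtx G v0 v1 v2 B0 B E m) {v : V} (hm : m v = 2) :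
    s(v0, v2) ∈ B ∧ (fromEdgeSet (B \ {s(v0, v2)})).Reachable v1 v2 ∧
    vType B0 v0 v1 v2 v = 2 ∧
    ∃ z, z ≠ v ∧ (fromEdgeSet E).Reachable v z ∧ 1 ≤ m z := by
  have k01 := c.hG.2.1
  have k02 := c.hG.2.2.1
  have k12 := c.hG.2.2.2.1
  have p1 := hx_par1 c.hG
  have p2 := hx_par2 c.hG
  have hv0 : v ≠ v0 := hx_marked_ne c (by omega)
  obtain ⟨h02, p, hp, hnp, i, h1, h2, rfl⟩ := (c.hphi.2.2.2 v).1 hm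
  obtain ⟨hreach, x', hx1, hx2, hx3, q, hq⟩ := hx_split p hp hnp i h1 h2
  refine ⟨h02, ?_, ?_, ?_⟩
  · refine Reachable.symm ⟨p.transfer _ ?_⟩
    intro e he
    have := p.edges_subset_edgeSet he
    rw [edgeSet_fromEdgeSet] at this ⊢
    exact ⟨⟨this.1, fun h => hnp (by rw [Set.mem_singleton_iff] at h; exact h ▸ he)⟩, this.2⟩
  · have hcl : ∀ u, (fromEdgeSet (B0 \ {s(v0, v2)})).Reachable v2 u →
        u = v2 ∨ (u ≠ v0 ∧ hxPar G v0 v1 v2 u = v2) := by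
      intro u hu
      refine hx_closed (P := fun u => u = v2 ∨ (u ≠ v0 ∧ hxPar G v0 v1 v2 u = v2)) ?_ hu
        (Or.inl rfl)
      intro a b hab ha
      rw [fromEdgeSet_adj] at hab
      obtain ⟨⟨hmem, hne⟩, _⟩ := hab
      rw [c.hB0] at hmem
      obtain ⟨w, hw, he⟩ := hmem
      rw [Sym2.eq_iff] at he
      rcases he with ⟨rfl, rfl⟩ | ⟨h, rfl⟩
      · rcases ha with rfl | ⟨ha0, ha1⟩
        · exfalso; apply hne; rw [p2, Set.mem_singleton_iff, Sym2.eq_swap]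
        · exact Or.inl ha1
      · rcases ha with rfl | ⟨ha0, ha1⟩
        · exact Or.inr ⟨hw, h.symm⟩
        · exfalso
          have hr := hx_par_root (G := G) (v0 := v0) (v1 := v1) (v2 := v2) b
          rw [← h] at hr
          rcases hr with rfl | rfl | rfl
          · exact ha0 rfl
          · rw [p1] at ha1; exact k02 ha1
          · rw [p2] at ha1; exact k02 ha1
    rcases hcl _ hreach with h | ⟨h0, h⟩
    · rw [h]; exact hx_ty2 c
    · apply hx_rt_eq2 c
      rw [hx_rt_ty c h0 ?_ ?_]
      · exact h
      · intro hh; rw [hh, p1] at h; exact k02 h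
      · intro hh; rw [hh, p2] at h; exact k02 h
  · refine hx_walk_mark c q rfl hv0 hq (hx_edge ?_)
    exact (hx_B_cases c hx1).resolve_right hx2

theorem hx_attach' (c : HxCtx G v0 v1 v2 B0 B E m) {x : V} {e : Sym2 V} (hx : 1 ≤ m x)
    (he : e = s(v0, v1) ∨ e = s(v0, v2)) :
    (fromEdgeSet (B \ {e})).Reachable x (hxRt v0 v1 v2 (vType B0 v0 v1 v2 x)) := by
  refine hx_attach c hx fun h1 h2 h => ?_
  have hx0 := hx_marked_ne c hx
  rcases he with rfl | rfl
  · rw [Sym2.eq_swap] at h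
    have := hx_up_inj c (x := v1) (y := x) c.hG.2.1.symm hx0 (by rw [hx_par1 c.hG]; exact h)
    exact h1 this.symm
  · rw [Sym2.eq_swap] at h
    have := hx_up_inj c (x := v2) (y := x) c.hG.2.2.1.symm hx0 (by rw [hx_par2 c.hG]; exact h)
    exact h2 this.symm

theorem hx_mixed (c : HxCtx G v0 v1 v2 B0 B E m) {x y : V} (hr : (fromEdgeSet E).Reachable x y)
    (hx : 1 ≤ m x) (ht : vType B0 v0 v1 v2 x = 0) (hy : m y = 2) : False := by
  obtain ⟨h02, _, hty, _⟩ := hx_dm c hy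
  have e1 := hx_attach' c hx (e := s(v0, v2)) (Or.inr rfl)
  have e2 := hx_attach' c (x := y) (by omega) (e := s(v0, v2)) (Or.inr rfl)
  rw [ht] at e1
  rw [hty] at e2
  simp only [hxRt] at e1 e2
  have e3 := hx_E_reach c (hx_e02 c) hr
  exact hx_bridge c.hB.2 c.hG.2.2.1 h02 (e1.symm.trans (e3.trans e2))

theorem hx_m_le (c : HxCtx G v0 v1 v2 B0 B E m) (x : V) : m x ≤ 2 := c.hphi.2.1 x

theorem hx_cnt_pos {u : V} {t : ℕ} (h : 1 ≤ markTypeCount B0 v0 v1 v2 E m u t) :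
    ∃ x, (fromEdgeSet E).Reachable u x ∧ 1 ≤ m x ∧
      (vType B0 v0 v1 v2 x = t ∨ (m x = 2 ∧ t = 0)) := by
  by_contra! hcon
  have : markTypeCount B0 v0 v1 v2 E m u t = 0 := by
    unfold markTypeCount
    refine Finset.sum_eq_zero fun x _ => ?_
    split_ifs with h1 h2 h3 h3
    · exact absurd h2.2 (hcon x h1 h2.1).1
    · exact absurd h2.2 (hcon x h1 h2.1).1
    · exact absurd h3.2 ((hcon x h1 (by omega)).2 h3.1)
    · rfl
    · rfl
  omega

theorem hx_pos_cnt {u x : V} {t : ℕ} (hr : (fromEdgeSet E).Reachable u x) (hx : 1 ≤ m x)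
    (h : vType B0 v0 v1 v2 x = t ∨ (m x = 2 ∧ t = 0)) :
    1 ≤ markTypeCount B0 v0 v1 v2 E m u t := by
  unfold markTypeCount
  refine le_trans ?_ (Finset.single_le_sum (fun _ _ => Nat.zero_le _) (Finset.mem_univ x))
  rw [if_pos hr]
  rcases h with h | h
  · rw [if_pos ⟨hx, h⟩]; omega
  · rw [if_pos h]; omega

theorem hx_cnt_le (c : HxCtx G v0 v1 v2 B0 B E m) (u : V) (t : ℕ) :
    markTypeCount B0 v0 v1 v2 E m u t ≤ 1 := by
  by_cases hp : 1 ≤ markTypeCount B0 v0 v1 v2 E m u t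
  swap
  · omega
  obtain ⟨x, hr, hx, ht⟩ := hx_cnt_pos hp
  unfold markTypeCount
  rw [Finset.sum_eq_single x]
  · rw [if_pos hr]
    split_ifs with h1 h2
    · have := (hx_dm c h2.1).2.2.1
      omega
    all_goals omega
  · intro y _ hyx
    by_cases hry : (fromEdgeSet E).Reachable u y
    swap
    · rw [if_neg hry]
    rw [if_pos hry]
    have hxy := hr.symm.trans hry
    have key : ∀ {y}, (fromEdgeSet E).Reachable x y → y ≠ x → 1 ≤ m y →
        ¬(vType B0 v0 v1 v2 y = t ∨ (m y = 2 ∧ t = 0)) := by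
      intro y hxy hyx hy hyt
      rcases ht with ht | ⟨ht, h0⟩ <;> rcases hyt with hyt | ⟨hyt, h0'⟩
      · exact hyx (hx_ty_inj c hx hy hxy (by omega)).symm
      · exact hx_mixed c hxy hx (by omega) hyt
      · exact hx_mixed c hxy.symm hy (by omega) ht
      · have t1 := (hx_dm c ht).2.2.1
        have t2 := (hx_dm c hyt).2.2.1
        exact hyx (hx_ty_inj c hx hy hxy (by omega)).symm
    rw [if_neg, if_neg]
    · rfl
    · rintro ⟨h1, h2⟩; exact key hxy hyx (by omega) (Or.inr ⟨h1, h2⟩)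
    · rintro ⟨h1, h2⟩; exact key hxy hyx h1 (Or.inl h2)
  · intro h; exact absurd (Finset.mem_univ x) h

theorem hx_comp (c : HxCtx G v0 v1 v2 B0 B E m) (u : V) :
    compMarks E m u = markTypeCount B0 v0 v1 v2 E m u 0 + markTypeCount B0 v0 v1 v2 E m u 1 +
      markTypeCount B0 v0 v1 v2 E m u 2 := by
  unfold compMarks markTypeCount
  rw [← Finset.sum_add_distrib, ← Finset.sum_add_distrib]
  refine Finset.sum_congr rfl fun x _ => ?_
  have h1 := hx_m_le c x
  have h2 := hx_ty_le (B0 := B0) (v0 := v0) (v1 := v1) (v2 := v2) x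
  generalize vType B0 v0 v1 v2 x = t at *
  generalize m x = k at *
  by_cases hr : (fromEdgeSet E).Reachable u x
  · simp only [hr, if_true]
    interval_cases t <;> interval_cases k <;> simp
  · simp only [hr, if_false]

theorem hx_bp_pos (a b : ℕ) : 1 ≤ bpMult B0 v0 v1 v2 E m a b ↔ ∃ u, u ≠ v0 ∧
      ((compMarks E m u = 2 ∧ a ≠ b ∧
          1 ≤ markTypeCount B0 v0 v1 v2 E m u a ∧ 1 ≤ markTypeCount B0 v0 v1 v2 E m u b) ∨
        (compMarks E m u = 3 ∧
          (({a, b} : Set ℕ) = {0, 1} ∨ ({a, b} : Set ℕ) = {0, 2}))) := by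
  unfold bpMult
  rw [Nat.one_le_iff_ne_zero, ← Nat.pos_iff_ne_zero, Set.ncard_pos (Set.toFinite _)]
  constructor
  · rintro ⟨_, u, hu, _, h⟩
    exact ⟨u, hu, h⟩
  · rintro ⟨u, hu, h⟩
    exact ⟨_, u, hu, rfl, h⟩

theorem hx_bp_comm {a b : ℕ} (h : 1 ≤ bpMult B0 v0 v1 v2 E m a b) :
    1 ≤ bpMult B0 v0 v1 v2 E m b a := by
  rw [hx_bp_pos] at h ⊢
  obtain ⟨u, hu, h | h⟩ := h
  · exact ⟨u, hu, Or.inl ⟨h.1, h.2.1.symm, h.2.2.2, h.2.2.1⟩⟩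
  · exact ⟨u, hu, Or.inr (by rw [Set.pair_comm b a]; exact h)⟩

theorem hx_conn_trans {a b d : ℕ} (ha : a ≤ 2) (hb : b ≤ 2) (hd : d ≤ 2)
    (h1 : bpConnected B0 v0 v1 v2 E m a b) (h2 : bpConnected B0 v0 v1 v2 E m b d) :
    bpConnected B0 v0 v1 v2 E m a d := by
  by_cases hab : a = b
  · rw [hab]; exact h2
  by_cases hbd : b = d
  · rw [← hbd]; exact h1
  by_cases had : a = d
  · exact Or.inl had
  have key : ∀ e ∈ ({0, 1, 2} : Set ℕ), e ≤ 2 := by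
    intro e he
    simp only [Set.mem_insert_iff, Set.mem_singleton_iff] at he
    omega
  rcases h1 with h | h1 | ⟨e, he, n1, n2, h3, h4⟩
  · exact absurd h hab
  · rcases h2 with h | h2 | ⟨e, he, n1, n2, h3, h4⟩
    · exact absurd h hbd
    · refine Or.inr (Or.inr ⟨b, ?_, Ne.symm hab, hbd, h1, h2⟩)
      simp only [Set.mem_insert_iff, Set.mem_singleton_iff]
      omega
    · have := key e he
      have hea : e = a := by omega
      rw [hea] at h4
      exact Or.inr (Or.inl h4)
  · have := key e he
    have hed : e = d := by omega
    rw [hed] at h3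
    exact Or.inr (Or.inl h3)

theorem hx_conn_symm {a b : ℕ}
    (h1 : bpConnected B0 v0 v1 v2 E m a b) : bpConnected B0 v0 v1 v2 E m b a := by
  rcases h1 with h | h | ⟨d, h, h1, h2, h3, h4⟩
  · exact Or.inl h.symm
  · exact Or.inr (Or.inl (hx_bp_comm h))
  · exact Or.inr (Or.inr ⟨d, h, h2, h1, hx_bp_comm h4, hx_bp_comm h3⟩)

/-- A 3-component makes the blueprint connected. -/
theorem hx_three {u : V} (hu : u ≠ v0) (h : compMarks E m u = 3) {a b : ℕ} (ha : a ≤ 2)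
    (hb : b ≤ 2) : bpConnected B0 v0 v1 v2 E m a b := by
  have h01 : bpConnected B0 v0 v1 v2 E m 0 1 :=
    Or.inr (Or.inl ((hx_bp_pos 0 1).2 ⟨u, hu, Or.inr ⟨h, Or.inl rfl⟩⟩))
  have h02 : bpConnected B0 v0 v1 v2 E m 0 2 :=
    Or.inr (Or.inl ((hx_bp_pos 0 2).2 ⟨u, hu, Or.inr ⟨h, Or.inr rfl⟩⟩))
  have key : ∀ {t}, t ≤ 2 → bpConnected B0 v0 v1 v2 E m 0 t := by
    intro t ht
    interval_cases t
    · exact Or.inl rfl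
    · exact h01
    · exact h02
  exact hx_conn_trans ha (by omega) hb (hx_conn_symm (key ha)) (key hb)

/-- Two marks in the same component have connected types. -/
theorem hx_conn_marks (c : HxCtx G v0 v1 v2 B0 B E m) {x y : V} (hx : 1 ≤ m x) (hy : 1 ≤ m y)
    (hr : (fromEdgeSet E).Reachable x y) :
    bpConnected B0 v0 v1 v2 E m (vType B0 v0 v1 v2 x) (vType B0 v0 v1 v2 y) := by
  by_cases hne : vType B0 v0 v1 v2 x = vType B0 v0 v1 v2 y
  · exact Or.inl hne
  have hx0 := hx_marked_ne c hx
  have l1 := hx_ty_le (B0 := B0) (v0 := v0) (v1 := v1) (v2 := v2) x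
  have l2 := hx_ty_le (B0 := B0) (v0 := v0) (v1 := v1) (v2 := v2) y
  have n1 := hx_pos_cnt (B0 := B0) (v0 := v0) (v1 := v1) (v2 := v2) (E := E)
    (Reachable.refl x) hx (Or.inl rfl)
  have n2 := hx_pos_cnt (B0 := B0) (v0 := v0) (v1 := v1) (v2 := v2) hr hy (Or.inl rfl)
  have hc := hx_comp c x
  have c0 := hx_cnt_le c x 0
  have c1 := hx_cnt_le c x 1
  have c2 := hx_cnt_le c x 2
  have h23 : compMarks E m x = 2 ∨ compMarks E m x = 3 := by
    generalize vType B0 v0 v1 v2 x = a at *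
    generalize vType B0 v0 v1 v2 y = b at *
    interval_cases a <;> interval_cases b <;> omega
  rcases h23 with h | h
  · exact Or.inr (Or.inl ((hx_bp_pos _ _).2 ⟨x, hx0, Or.inl ⟨h, hne, n1, n2⟩⟩))
  · exact hx_three hx0 h l1 l2

/-- Without double marks, blueprint edges are realised in `B` minus `01` or `02`. -/
theorem hx_bp_reach (c : HxCtx G v0 v1 v2 B0 B E m) {e : Sym2 V}
    (he : e = s(v0, v1) ∨ e = s(v0, v2)) (hm : ∀ x, m x ≠ 2) {a b : ℕ} (ha : a ≤ 2)
    (hb : b ≤ 2) (h : 1 ≤ bpMult B0 v0 v1 v2 E m a b) :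
    (fromEdgeSet (B \ {e})).Reachable (hxRt v0 v1 v2 a) (hxRt v0 v1 v2 b) := by
  have heB : e ∈ B0 := by
    rcases he with rfl | rfl
    · exact hx_e01 c
    · exact hx_e02 c
  rw [hx_bp_pos] at h
  obtain ⟨u, hu, h⟩ := h
  have hab : 1 ≤ markTypeCount B0 v0 v1 v2 E m u a ∧ 1 ≤ markTypeCount B0 v0 v1 v2 E m u b := by
    rcases h with h | h
    · exact h.2.2
    · have hc := hx_comp c u
      have c0 := hx_cnt_le c u 0
      have c1 := hx_cnt_le c u 1
      have c2 := hx_cnt_le c u 2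
      have : ∀ t ≤ 2, 1 ≤ markTypeCount B0 v0 v1 v2 E m u t := by
        intro t ht
        interval_cases t <;> omega
      exact ⟨this a ha, this b hb⟩
  obtain ⟨x, rx, mx, tx⟩ := hx_cnt_pos hab.1
  obtain ⟨y, ry, my, ty⟩ := hx_cnt_pos hab.2
  have tx' := tx.resolve_right (fun h => hm x h.1)
  have ty' := ty.resolve_right (fun h => hm y h.1)
  have e1 := hx_attach' c mx he
  have e2 := hx_attach' c my he
  rw [tx'] at e1
  rw [ty'] at e2
  exact e1.symm.trans ((hx_E_reach c heB (rx.symm.trans ry)).trans e2)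

theorem hx_conn_reach (c : HxCtx G v0 v1 v2 B0 B E m) {e : Sym2 V}
    (he : e = s(v0, v1) ∨ e = s(v0, v2)) (hm : ∀ x, m x ≠ 2) {a b : ℕ} (ha : a ≤ 2)
    (hb : b ≤ 2) (h : bpConnected B0 v0 v1 v2 E m a b) :
    (fromEdgeSet (B \ {e})).Reachable (hxRt v0 v1 v2 a) (hxRt v0 v1 v2 b) := by
  rcases h with h | h | ⟨d, hd, _, _, h1, h2⟩
  · rw [h]
  · exact hx_bp_reach c he hm ha hb h
  · have hd' : d ≤ 2 := by
      simp only [Set.mem_insert_iff, Set.mem_singleton_iff] at hd; omega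
    exact (hx_bp_reach c he hm ha hd' h1).trans (hx_bp_reach c he hm hd' hb h2)

/-- Connectedness of the blueprint in terms of the edges `01` and `02`. -/
theorem hx_bp (c : HxCtx G v0 v1 v2 B0 B E m) :
    (bpConnected B0 v0 v1 v2 E m 0 1 ∧ bpConnected B0 v0 v1 v2 E m 0 2 ∧
        bpConnected B0 v0 v1 v2 E m 1 2) ↔
    (s(v0, v1) ∉ B ∧
      (s(v0, v2) ∈ B → (fromEdgeSet (B \ {s(v0, v2)})).Reachable v1 v2)) := by
  have k01 := c.hG.2.1
  have k02 := c.hG.2.2.1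
  have k12 := c.hG.2.2.2.1
  have mk1 : 1 ≤ m v1 := (hx_marked c v1).2 (Or.inl rfl)
  have mk2 : 1 ≤ m v2 := (hx_marked c v2).2 (Or.inr (Or.inl rfl))
  constructor
  · rintro ⟨b01, b02, b12⟩
    constructor
    · intro h01
      have hm : ∀ x, m x ≠ 2 := by
        intro x hx
        obtain ⟨h02, hr, _⟩ := hx_dm c hx
        refine hx_bridge c.hB.2 k02 h02 (Reachable.trans (hx_edge ⟨h01, ?_⟩) hr)
        rw [Set.mem_singleton_iff, Sym2.eq_iff]
        rintro (⟨_, h⟩ | ⟨h, _⟩)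
        · exact k12 h
        · exact k02 h
      have := hx_conn_reach c (e := s(v0, v1)) (Or.inl rfl) hm (by omega) (by omega) b01
      simp only [hxRt] at this
      exact hx_bridge c.hB.2 k01 h01 this
    · intro h02
      by_contra hnr
      have hm : ∀ x, m x ≠ 2 := fun x hx => hnr (hx_dm c hx).2.1
      have := hx_conn_reach c (e := s(v0, v2)) (Or.inr rfl) hm (by omega) (by omega) b02
      simp only [hxRt] at this
      exact hx_bridge c.hB.2 k02 h02 this
  · rintro ⟨h01, h02⟩
    by_cases hB02 : s(v0, v2) ∈ B
    · obtain ⟨p, hp⟩ := (h02 hB02).symm.exists_isPath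
      have hle : fromEdgeSet (B \ {s(v0, v2)}) ≤ fromEdgeSet B :=
        fromEdgeSet_mono Set.sdiff_subset
      have hedges : ∀ e ∈ p.edges, e ∈ B ∧ e ≠ s(v0, v2) := by
        intro e he
        have := p.edges_subset_edgeSet he
        rw [edgeSet_fromEdgeSet] at this
        exact this.1
      have hex : ∃ e ∈ p.edges, e ∉ B0 := by
        by_contra! hall
        refine hx_bridge (hx_B0_tree c).2 k02 (hx_e02 c) (Reachable.trans (v := v1) ?_ ?_)
        · refine hx_edge ⟨hx_e01 c, ?_⟩
          rw [Set.mem_singleton_iff, Sym2.eq_iff]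
          rintro (⟨_, h⟩ | ⟨h, _⟩)
          · exact k12 h
          · exact k02 h
        · refine Reachable.symm ⟨p.transfer _ ?_⟩
          intro e he
          have := p.edges_subset_edgeSet he
          rw [edgeSet_fromEdgeSet] at this ⊢
          exact ⟨⟨hall e he, (hedges e he).2⟩, this.2⟩
      obtain ⟨i, hi1, hi2⟩ := hx_first p.edges hex
      have hdm : DoublyMarkedAt B0 B v0 v1 v2 ((p.mapLe hle).getVert i) := by
        refine ⟨hB02, p.mapLe hle, ?_, ?_, i, ?_, ?_, rfl⟩
        · exact (Walk.isPath_mapLe hle).2 hp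
        · rw [Walk.edges_mapLe_eq_edges]
          exact fun h => (hedges _ h).2 rfl
        · rw [Walk.edges_mapLe_eq_edges]; exact hi1
        · rw [Walk.edges_mapLe_eq_edges]; exact hi2
      generalize (p.mapLe hle).getVert i = v at hdm
      have hm := (c.hphi.2.2.2 v).2 hdm
      obtain ⟨_, _, hty, z, hzv, hz, mz⟩ := hx_dm c hm
      have hv0 : v ≠ v0 := hx_marked_ne c (by omega)
      have hz2 : vType B0 v0 v1 v2 z ≠ 2 := fun h =>
        hzv (hx_ty_inj c (by omega) mz hz (by omega)).symm
      have hz0 : vType B0 v0 v1 v2 z ≠ 0 := fun h => hx_mixed c hz.symm mz h hm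
      have hzl := hx_ty_le (B0 := B0) (v0 := v0) (v1 := v1) (v2 := v2) z
      have n0 : 1 ≤ markTypeCount B0 v0 v1 v2 E m v 0 :=
        hx_pos_cnt (Reachable.refl v) (by omega) (Or.inr ⟨hm, rfl⟩)
      have n2 : 1 ≤ markTypeCount B0 v0 v1 v2 E m v 2 :=
        hx_pos_cnt (Reachable.refl v) (by omega) (Or.inl hty)
      have n1 : 1 ≤ markTypeCount B0 v0 v1 v2 E m v 1 :=
        hx_pos_cnt hz mz (Or.inl (by omega))
      have hc := hx_comp c v
      have c0 := hx_cnt_le c v 0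
      have c1 := hx_cnt_le c v 1
      have c2 := hx_cnt_le c v 2
      have h3 : compMarks E m v = 3 := by omega
      exact ⟨hx_three hv0 h3 (by omega) (by omega), hx_three hv0 h3 (by omega) (by omega),
        hx_three hv0 h3 (by omega) (by omega)⟩
    · have tyl : ∀ x, vType B0 v0 v1 v2 x ≤ 2 := fun x => hx_ty_le x
      have t1 : vType B0 v0 v1 v2 v1 = 1 := hx_ty1
      have t2 := hx_ty2 c
      have inv : ∀ u, u = v0 ∨ ∃ y, (fromEdgeSet E).Reachable u y ∧ 1 ≤ m y ∧
          bpConnected B0 v0 v1 v2 E m 0 (vType B0 v0 v1 v2 y) := by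
        intro u
        refine hx_closed (P := fun u => u = v0 ∨ ∃ y, (fromEdgeSet E).Reachable u y ∧ 1 ≤ m y ∧
          bpConnected B0 v0 v1 v2 E m 0 (vType B0 v0 v1 v2 y)) ?_
          (c.hB.2.connected.preconnected v0 u) (Or.inl rfl)
        intro a b hab ha
        rw [fromEdgeSet_adj] at hab
        rcases hx_B_cases c hab.1 with hE | hE
        · have hrab := hx_edge hE
          rcases ha with rfl | ⟨y, hy, hy'⟩
          · exact Or.inl (by_contra fun hb => hx_E_ne c hrab.symm hb rfl)
          · exact Or.inr ⟨y, hrab.symm.trans hy, hy'⟩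
        · rw [c.hB0] at hE
          obtain ⟨w, hw, he⟩ := hE
          have hwB : s(w, hxPar G v0 v1 v2 w) ∈ B := he ▸ hab.1
          have hw1 : w ≠ v1 := by
            rintro rfl; rw [hx_par1 c.hG, Sym2.eq_swap] at hwB; exact h01 hwB
          have hw2 : w ≠ v2 := by
            rintro rfl; rw [hx_par2 c.hG, Sym2.eq_swap] at hwB; exact hB02 hwB
          have hmw : 1 ≤ m w := (hx_marked c w).2 (Or.inr (Or.inr ⟨hw, hwB⟩))
          have hrt := hx_rt_ty c hw hw1 hw2
          have hwl := tyl w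
          rw [Sym2.eq_iff] at he
          rcases he with ⟨rfl, rfl⟩ | ⟨rfl, rfl⟩
          · -- from the child to the parent
            obtain ⟨y, hy, my, hcy⟩ := ha.resolve_left hw
            have hct : bpConnected B0 v0 v1 v2 E m 0 (vType B0 v0 v1 v2 a) :=
              hx_conn_trans (by omega) (tyl y) (tyl a) hcy (hx_conn_marks c my hmw hy.symm)
            rw [← hrt]
            generalize vType B0 v0 v1 v2 a = t at *
            interval_cases t
            · left; simp [hxRt]
            · right; simp only [hxRt, if_true]
              exact ⟨v1, Reachable.refl _, mk1, by rw [t1]; exact hct⟩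
            · right; simp only [hxRt]
              exact ⟨v2, Reachable.refl _, mk2, by rw [t2]; exact hct⟩
          · -- from the parent to the child
            right
            refine ⟨b, Reachable.refl _, hmw, ?_⟩
            rw [← hrt] at ha
            generalize vType B0 v0 v1 v2 b = t at *
            interval_cases t
            · exact Or.inl rfl
            · simp only [hxRt, if_true] at ha
              obtain ⟨y, hy, my, hcy⟩ := ha.resolve_left k01.symm
              have := hx_conn_marks c my mk1 hy.symm
              rw [t1] at this
              exact hx_conn_trans (by omega) (tyl y) (by omega) hcy this
            · simp only [hxRt] at ha
              obtain ⟨y, hy, my, hcy⟩ := ha.resolve_left k02.symm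
              have := hx_conn_marks c my mk2 hy.symm
              rw [t2] at this
              exact hx_conn_trans (by omega) (tyl y) (by omega) hcy this
      have c01 : bpConnected B0 v0 v1 v2 E m 0 1 := by
        obtain ⟨y, hy, my, hcy⟩ := (inv v1).resolve_left k01.symm
        have := hx_conn_marks c my mk1 hy.symm
        rw [t1] at this
        exact hx_conn_trans (by omega) (tyl y) (by omega) hcy this
      have c02 : bpConnected B0 v0 v1 v2 E m 0 2 := by
        obtain ⟨y, hy, my, hcy⟩ := (inv v2).resolve_left k02.symm
        have := hx_conn_marks c my mk2 hy.symm
        rw [t2] at this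
        exact hx_conn_trans (by omega) (tyl y) (by omega) hcy this
      exact ⟨c01, c02, hx_conn_trans (by omega) (by omega) (by omega) (hx_conn_symm c01) c02⟩


/-- Edges of `B` outside `B0` are internally passive. -/
theorem hx_pass_out (c : HxCtx G v0 v1 v2 B0 B E m) {e : Sym2 V} (he : e ∈ B) (h0 : e ∉ B0) :
    InternallyPassive G B e := by
  induction e using Sym2.ind with
  | _ a b =>
  have heG : s(a, b) ∈ G.edgeSet := c.hB.1 he
  have hab : a ≠ b := G.ne_of_adj heG
  by_contra hnp
  refine hx_bridge c.hB.2 hab he ?_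
  refine hx_closed (P := fun u => (fromEdgeSet (B \ {s(a, b)})).Reachable a u) ?_
    ((hx_B0_tree c).2.connected.preconnected a b) (Reachable.refl a)
  intro p q hpq hp
  rw [fromEdgeSet_adj] at hpq
  have hfG : s(p, q) ∈ G.edgeSet := (hx_B0_tree c).1 hpq.1
  have hf := hpq.1
  rw [c.hB0, hx_S_block c.hG hfG] at hf
  rw [c.hB0, hx_S_block c.hG heG] at h0
  have hlt : s(p, q) < s(a, b) := c.heo.1 _ hfG _ heG (by omega)
  by_contra hq
  exact hnp (hx_passive c.hB he hfG hlt fun h => hq (hp.trans h))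

/-- An edge smaller than an edge incident to `v0` is incident to `v0`. -/
theorem hx_lt_zero (c : HxCtx G v0 v1 v2 B0 B E m) {f : Sym2 V} {x : V} (hf : f ∈ G.edgeSet)
    (hx : G.Adj v0 x) (hlt : f < s(v0, x)) : ∃ y, f = s(v0, y) ∧ G.Adj v0 y ∧ y < x := by
  have hb : edgeBlock G v0 v1 v2 s(v0, x) = 0 := by
    unfold edgeBlock; rw [if_pos]; exact Sym2.mem_mk_left _ _
  have hfb : edgeBlock G v0 v1 v2 f = 0 := by
    by_contra h
    exact lt_asymm hlt (c.heo.1 _ hx _ hf (by omega))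
  have hmem : v0 ∈ f := by
    by_contra h
    unfold edgeBlock at hfb
    rw [if_neg h] at hfb
    split_ifs at hfb
  obtain ⟨y, rfl⟩ := hmem
  refine ⟨y, rfl, hf, ?_⟩
  rcases lt_trichotomy y x with h | h | h
  · exact h
  · rw [h] at hlt; exact absurd hlt (lt_irrefl _)
  · exact absurd (hx_zero_lt c hx hf h) (lt_asymm hlt)

theorem hx_ge1 (c : HxCtx G v0 v1 v2 B0 B E m) {y : V} (hy : G.Adj v0 y) (h : y ≠ v1) :
    v2 ≤ y := by
  by_cases h2 : y = v2
  · exact h2.ge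
  · exact (c.hvo.2.2.1 y hy.ne' h h2).le

theorem hx_01 (c : HxCtx G v0 v1 v2 B0 B E m) : ¬InternallyPassive G B s(v0, v1) := by
  rintro ⟨_, f, hf, _, hlt, _⟩
  obtain ⟨y, rfl, hy, hyl⟩ := hx_lt_zero c hf c.hG.2.2.2.2.1 hlt
  have := hx_ge1 c hy hyl.ne
  exact absurd (this.trans_lt (hyl.trans c.hvo.2.1)) (lt_irrefl _)

theorem hx_02 (c : HxCtx G v0 v1 v2 B0 B E m) (h : s(v0, v2) ∈ B) :
    InternallyPassive G B s(v0, v2) ↔ (fromEdgeSet (B \ {s(v0, v2)})).Reachable v1 v2 := by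
  have a1 := c.hG.2.2.2.2.1
  have a2 := c.hG.2.2.2.2.2.1
  constructor
  · rintro ⟨_, f, hf, hfB, hlt, hT⟩
    obtain ⟨y, rfl, hy, hyl⟩ := hx_lt_zero c hf a2 hlt
    have hy1 : y = v1 := by
      by_contra h1
      exact absurd ((hx_ge1 c hy h1).trans_lt hyl) (lt_irrefl _)
    rw [hy1] at hfB hT
    have := hx_cross c.hG.2.1 hfB hT
    exact ((hx_side c.hB.2 (a := v0) (b := v2) v1).resolve_left this).symm
  · intro hr
    refine hx_passive c.hB h a1 (hx_zero_lt c a1 a2 c.hvo.2.1) fun h1 => ?_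
    exact hx_bridge c.hB.2 c.hG.2.2.1 h (h1.trans hr)

theorem hx_comp_one (c : HxCtx G v0 v1 v2 B0 B E m) {x : V} (hx : 1 ≤ m x) :
    compMarks E m x = 1 ↔
      (m x = 1 ∧ ∀ y, y ≠ x → (fromEdgeSet E).Reachable x y → m y = 0) := by
  have hs : compMarks E m x = m x + ∑ y ∈ Finset.univ.erase x,
      if (fromEdgeSet E).Reachable x y then m y else 0 := by
    unfold compMarks
    rw [← Finset.add_sum_erase _ _ (Finset.mem_univ x), if_pos (Reachable.refl x)]
  rw [hs]
  constructor
  · intro h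
    refine ⟨by omega, fun y hy hr => ?_⟩
    have h0 : (∑ y ∈ Finset.univ.erase x,
      if (fromEdgeSet E).Reachable x y then m y else 0) = 0 := by omega
    rw [Finset.sum_eq_zero_iff] at h0
    have := h0 y (Finset.mem_erase.2 ⟨hy, Finset.mem_univ y⟩)
    rwa [if_pos hr] at this
  · rintro ⟨h1, h2⟩
    rw [h1, Nat.add_eq_left]
    refine Finset.sum_eq_zero fun y hy => ?_
    split_ifs with hr
    · exact h2 y (Finset.ne_of_mem_erase hy) hr
    · rfl

/-- Passivity of the edges of `B` from a normal marked vertex to its parent: first half. -/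
theorem hx_norm1 (c : HxCtx G v0 v1 v2 B0 B E m) {x : V} (hx1 : x ≠ v1)
    (hx2 : x ≠ v2) (hx : 1 ≤ m x)
    (hnp : ¬InternallyPassive G B s(x, hxPar G v0 v1 v2 x)) :
    compMarks E m x = 1 ∧ ∀ u, (fromEdgeSet E).Reachable x u → x ≤ u := by
  have hx0 := hx_marked_ne c hx
  have heB := hx_up_mem c hx hx1 hx2
  have heB0 := hx_B0_mem c hx0
  have hlt := hx_root_lt c hx0 hx1 hx2
  have hadj := hx_par_adj c.hG hx0
  have r1 : (fromEdgeSet (B \ {s(x, hxPar G v0 v1 v2 x)})).Reachable v0 v1 := by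
    by_contra h
    exact hnp (hx_passive c.hB heB c.hG.2.2.2.2.1 hlt.1 h)
  have r2 : (fromEdgeSet (B \ {s(x, hxPar G v0 v1 v2 x)})).Reachable v0 v2 := by
    by_contra h
    exact hnp (hx_passive c.hB heB c.hG.2.2.2.2.2.1 hlt.2 h)
  have root : ∀ r, (r = v0 ∨ r = v1 ∨ r = v2) →
      (fromEdgeSet (B \ {s(x, hxPar G v0 v1 v2 x)})).Reachable v0 r := by
    rintro r (rfl | rfl | rfl)
    · exact Reachable.refl _
    · exact r1
    · exact r2
  have nr : ∀ r, (r = v0 ∨ r = v1 ∨ r = v2) →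
      ¬(fromEdgeSet (B \ {s(x, hxPar G v0 v1 v2 x)})).Reachable x r := by
    intro r hr h
    exact hx_bridge c.hB.2 hadj.ne heB
      (h.trans ((root r hr).symm.trans (root _ (hx_par_root x))))
  have other : ∀ y, y ≠ x → (fromEdgeSet E).Reachable x y → ¬1 ≤ m y := by
    intro y hyx hr hy
    refine nr _ (hx_rt_root (vType B0 v0 v1 v2 y)) ((hx_E_reach c heB0 hr).trans
      (hx_attach c hy fun _ _ h => hyx ?_))
    exact (hx_up_inj c hx0 (hx_marked_ne c hy) h).symm
  refine ⟨(hx_comp_one c hx).2 ⟨?_, fun y h1 h2 => ?_⟩, fun u hu => ?_⟩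
  · have := hx_m_le c x
    by_contra h
    obtain ⟨_, _, _, z, hz, hr, hmz⟩ := hx_dm c (v := x) (by omega)
    exact other z hz hr hmz
  · have := other y h1 h2
    omega
  · by_contra hux
    rw [not_le] at hux
    have hu0 := hx_E_ne c hu hx0
    have hu1 : u ≠ v1 := by
      rintro rfl; exact other _ hux.ne hu ((hx_marked c _).2 (Or.inl rfl))
    have hu2 : u ≠ v2 := by
      rintro rfl; exact other _ hux.ne hu ((hx_marked c _).2 (Or.inr (Or.inl rfl)))
    refine hnp (hx_passive c.hB heB (hx_par_adj c.hG hu0)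
      (hx_up_lt c hu0 hu1 hu2 hx0 hx1 hx2 hux) fun h => ?_)
    exact nr _ (hx_par_root u) ((hx_E_reach c heB0 hu).trans h)

/-- Passivity of the edges of `B` from a normal marked vertex to its parent: second half. -/
theorem hx_norm2 (c : HxCtx G v0 v1 v2 B0 B E m) {x : V} (hx1 : x ≠ v1)
    (hx2 : x ≠ v2) (hx : 1 ≤ m x)
    (hc : compMarks E m x = 1) (hmin : ∀ u, (fromEdgeSet E).Reachable x u → x ≤ u) :
    ¬InternallyPassive G B s(x, hxPar G v0 v1 v2 x) := by
  have hx0 := hx_marked_ne c hx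
  obtain ⟨_, hoth⟩ := (hx_comp_one c hx).1 hc
  have heB0 := hx_B0_mem c hx0
  have hn1 : ¬(fromEdgeSet E).Reachable x v1 := fun h => by
    have := hoth _ hx1.symm h
    have := (hx_marked c v1).2 (Or.inl rfl)
    omega
  have hn2 : ¬(fromEdgeSet E).Reachable x v2 := fun h => by
    have := hoth _ hx2.symm h
    have := (hx_marked c v2).2 (Or.inr (Or.inl rfl))
    omega
  have hcl : ∀ u, (fromEdgeSet (B \ {s(x, hxPar G v0 v1 v2 x)})).Reachable x u →
      (fromEdgeSet E).Reachable x u := by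
    intro u hu
    refine hx_closed (P := fun u => (fromEdgeSet E).Reachable x u) ?_ hu (Reachable.refl x)
    intro z w hzw hz
    rw [fromEdgeSet_adj] at hzw
    obtain ⟨⟨hB, hne⟩, _⟩ := hzw
    rcases hx_B_cases c hB with h | h
    · exact hz.trans (hx_edge h)
    · exfalso
      obtain ⟨hmz, hw⟩ := hx_leave c (hx_E_ne c hz hx0) hB h
      have hzx : z = x := by
        by_contra hzx
        have := hoth z hzx hz
        omega
      rw [hzx] at hw hne
      rw [(hw.resolve_left hx1).resolve_left hx2] at hne
      exact hne rfl
  have main : ∀ a b, s(a, b) ∈ G.edgeSet → s(a, b) ∉ B →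
      s(a, b) < s(x, hxPar G v0 v1 v2 x) →
      (fromEdgeSet (B \ {s(x, hxPar G v0 v1 v2 x)})).Reachable x a → False := by
    intro a b hG hnB hlt hr
    have ha := hcl a hr
    have ha0 := hx_E_ne c ha hx0
    have ha1 : a ≠ v1 := fun h => hn1 (h ▸ ha)
    have ha2 : a ≠ v2 := fun h => hn2 (h ▸ ha)
    have heG : s(x, hxPar G v0 v1 v2 x) ∈ G.edgeSet := hx_par_adj c.hG hx0
    have hb1 : edgeBlock G v0 v1 v2 s(x, hxPar G v0 v1 v2 x) ≤ 2 :=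
      (hx_S_block c.hG heG).1 (c.hB0 ▸ heB0)
    have hb2 : edgeBlock G v0 v1 v2 s(a, b) ≤ 2 := by
      by_contra h
      exact lt_asymm hlt (c.heo.1 _ heG _ hG (by omega))
    obtain ⟨w, hw, he⟩ := (hx_S_block c.hG hG).2 hb2
    have hwa : a = w ∧ b = hxPar G v0 v1 v2 w := by
      rw [Sym2.eq_iff] at he
      rcases he with h | ⟨h, _⟩
      · exact h
      · exfalso
        rcases hx_par_root (G := G) (v0 := v0) (v1 := v1) (v2 := v2) w with h' | h' | h'
        · exact ha0 (h.trans h')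
        · exact ha1 (h.trans h')
        · exact ha2 (h.trans h')
    obtain ⟨rfl, rfl⟩ := hwa
    have hxa : x ≠ a := by
      rintro rfl
      exact lt_irrefl _ hlt
    exact lt_asymm hlt
      (hx_up_lt c hx0 hx1 hx2 ha0 ha1 ha2 (lt_of_le_of_ne (hmin a ha) hxa))
  rintro ⟨heB, f, hf, hfB, hlt, hT⟩
  induction f using Sym2.ind with
  | _ a b =>
  have hcr := hx_cross (G.ne_of_adj hf) hfB hT
  have sa := hx_side c.hB.2 (a := x) (b := hxPar G v0 v1 v2 x) a
  have sb := hx_side c.hB.2 (a := x) (b := hxPar G v0 v1 v2 x) b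
  rcases sa with sa | sa
  · exact main a b hf hfB hlt sa
  · rcases sb with sb | sb
    · rw [Sym2.eq_swap] at hf hfB hlt
      exact main b a hf hfB hlt sb
    · exact hcr (sa.symm.trans sb)

theorem hx_main (c : HxCtx G v0 v1 v2 B0 B E m) :
    (∀ e ∈ B, InternallyPassive G B e) ↔
      (bpConnected B0 v0 v1 v2 E m 0 1 ∧ bpConnected B0 v0 v1 v2 E m 0 2 ∧
        bpConnected B0 v0 v1 v2 E m 1 2 ∧
        ¬∃ v, v ≠ v0 ∧ v ≠ v1 ∧ v ≠ v2 ∧ 1 ≤ m v ∧ compMarks E m v = 1 ∧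
          ∀ u, (SimpleGraph.fromEdgeSet E).Reachable v u → v ≤ u) := by
  have hbp := hx_bp c
  constructor
  · intro hall
    obtain ⟨b1, b2, b3⟩ := hbp.2 ⟨fun h => hx_01 c (hall _ h),
      fun h => (hx_02 c h).1 (hall _ h)⟩
    refine ⟨b1, b2, b3, ?_⟩
    rintro ⟨v, _, h1, h2, hm, hc, hmin⟩
    exact hx_norm2 c h1 h2 hm hc hmin (hall _ (hx_up_mem c hm h1 h2))
  · rintro ⟨b1, b2, b3, hbad⟩
    obtain ⟨n01, h02⟩ := hbp.1 ⟨b1, b2, b3⟩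
    intro e he
    by_cases h0 : e ∈ B0
    swap
    · exact hx_pass_out c he h0
    rw [c.hB0] at h0
    obtain ⟨u, hu, rfl⟩ := h0
    by_cases h1 : u = v1
    · rw [h1, hx_par1 c.hG, Sym2.eq_swap] at he
      exact absurd he n01
    by_cases h2 : u = v2
    · rw [h2, hx_par2 c.hG, Sym2.eq_swap] at he ⊢
      exact (hx_02 c he).2 (h02 he)
    have hm : 1 ≤ m u := (hx_marked c u).2 (Or.inr (Or.inr ⟨hu, he⟩))
    by_contra hnp
    obtain ⟨hc, hmin⟩ := hx_norm1 c h1 h2 hm hnp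
    exact hbad ⟨u, hu, h1, h2, hm, hc, hmin⟩


end Helpers

section Statements

variable (G : SimpleGraph V) (v0 v1 v2 : V) (B0 : Set (Sym2 V))

theorem statement11
    (hG : IsTriconed G v0 v1 v2)
    (hvo : VertexOrderSpec G v0 v1 v2)
    (heo : EdgeOrderSpec G v0 v1 v2)
    (hnc : NoColoops G)
    (hB0 : IsMinSpanningTree G B0)
    (B : Set (Sym2 V)) (hB : IsSpanningTree G B)
    (E : Set (Sym2 V)) (m : V → ℕ)
    (hphi : IsPhi1 G v0 v1 v2 B0 B E m) :
    (∀ e ∈ B, InternallyPassive G B e) ↔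
      (bpConnected B0 v0 v1 v2 E m 0 1 ∧ bpConnected B0 v0 v1 v2 E m 0 2 ∧
        bpConnected B0 v0 v1 v2 E m 1 2 ∧
        ¬∃ v, v ≠ v0 ∧ v ≠ v1 ∧ v ≠ v2 ∧ 1 ≤ m v ∧ compMarks E m v = 1 ∧
          ∀ u, (SimpleGraph.fromEdgeSet E).Reachable v u → v ≤ u) := by
  exact hx_main ⟨hG, hvo, heo, hx_B0_eq hG heo hB0, hB, hphi⟩

end Statements
end
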